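/- Let h be a hyperexponential term given in standard form h = c0·exp(a/b)·∏_{ℓ=1}^L c_ℓ^{e_ℓ} satisfying the nondegeneracy assumptions, and suppose deg_x a > deg_x b. Set ψ = γ + φ3 − 2, ϑ = (α+β)·(2γ−1+φ3) + γ − 1, and φ = deg_x c0 + (α+β+1)·deg_y c0 + (γ−2+φ3)·(deg_x c0 − α − β − φ2) − (1−φ2)·max{γ−2+φ3, 0}·(φ1 + (1/2)·β·(γ−1+φ3)). Then for all integers r and d with r ≥ ψ + 1 and d > (ϑ·r + φ)/(r − ψ), there exists a creative telescoping relation for h of order at most r and degree at most d. -/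

import Mathlib

open Polynomial Finset

/-- The derivative with respect to `y` on `K[y][x]`
(we represent bivariate polynomials as `Polynomial (Polynomial K)`,
the *outer* variable being `x`, the *inner* variable being `y`). -/
noncomputable def DY {K : Type*} [CommRing K] (p : Polynomial (Polynomial K)) :
    Polynomial (Polynomial K) :=
  p.sum fun n a => Polynomial.C (Polynomial.derivative a) * Polynomial.X ^ n

/-- The degree with respect to `y` of an element of `K[y][x]`. -/
noncomputable def degY {K : Type*} [CommRing K] (p : Polynomial (Polynomial K)) : ℕ :=
  p.support.sup fun n => (p.coeff n).natDegree

/-- The embedding of `K[x]` into `K[y][x]` (polynomials free of `y`). -/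
noncomputable def liftX {K : Type*} [CommRing K] (p : Polynomial K) :
    Polynomial (Polynomial K) :=
  p.map (Polynomial.C : K →+* Polynomial K)

/-- The falling factorial `z(z-1)⋯(z-n+1)` of an element of `K`. -/
noncomputable def ffall {K : Type*} [Field K] (z : K) (n : ℕ) : K :=
  ∏ j ∈ Finset.range n, (z - (j : K))

section Swap

variable {K : Type*} [Field K]

theorem coeff_coeff_swap (p : K[X][X]) (i j : ℕ) :
    ((Bivariate.swap p).coeff j).coeff i = (p.coeff i).coeff j := by
  induction p using Polynomial.induction_on' with
  | add p q hp hq => simp [hp, hq]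
  | monomial n f =>
    induction f using Polynomial.induction_on' with
    | add p q hp hq =>
      simp only [map_add, coeff_add, hp, hq]
    | monomial m t =>
      rw [Bivariate.swap_monomial_monomial]
      simp only [coeff_monomial]
      split_ifs <;> simp_all [coeff_monomial]

theorem coeff_DY (p : K[X][X]) (n : ℕ) : (DY p).coeff n = derivative (p.coeff n) := by
  rw [DY, Polynomial.sum, finsetSum_coeff]
  simp only [coeff_C_mul, coeff_X_pow, mul_ite, mul_one, mul_zero]
  rw [Finset.sum_ite_eq]
  split_ifs with hn
  · rfl
  · rw [notMem_support_iff.mp hn, derivative_zero]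

theorem swap_DY (p : K[X][X]) :
    Bivariate.swap (DY p) = derivative (Bivariate.swap p) := by
  ext j i
  rw [coeff_coeff_swap, coeff_DY, coeff_derivative, coeff_derivative]
  have : ((j : K[X]) + 1) = C ((j : K) + 1) := by simp
  rw [this, coeff_mul_C, coeff_coeff_swap]

theorem natDegree_swap (p : K[X][X]) : (Bivariate.swap p).natDegree = degY p := by
  apply le_antisymm
  · rw [natDegree_le_iff_coeff_eq_zero]
    intro N hN
    ext i
    rw [coeff_coeff_swap, coeff_zero]
    by_cases hi : i ∈ p.support
    · exact coeff_eq_zero_of_natDegree_lt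
        (lt_of_le_of_lt (Finset.le_sup (f := fun n => (p.coeff n).natDegree) hi) hN)
    · rw [notMem_support_iff.mp hi, coeff_zero]
  · refine Finset.sup_le fun i _ => ?_
    rw [natDegree_le_iff_coeff_eq_zero]
    intro N hN
    rw [← coeff_coeff_swap, coeff_eq_zero_of_natDegree_lt hN, coeff_zero]

/-- The derivation `DY` of `K[y][x]`, bundled. -/
noncomputable def derivY (K : Type*) [Field K] : Derivation K K[X][X] K[X][X] :=
  Derivation.mk'
    { toFun := DY
      map_add' := fun p q => by
        apply (Bivariate.swap (R := K)).injective
        simp only [swap_DY, map_add]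
      map_smul' := fun k p => by
        apply (Bivariate.swap (R := K)).injective
        simp only [swap_DY, map_smul, RingHom.id_apply, derivative_smul] }
    fun p q => by
      apply (Bivariate.swap (R := K)).injective
      simp only [LinearMap.coe_mk, AddHom.coe_mk, swap_DY, map_mul, derivative_mul, smul_eq_mul,
        map_add]
      ring

theorem derivY_apply (p : K[X][X]) : derivY K p = DY p := rfl

/-- The derivation of `K[y][x]` with respect to the outer variable `x`, bundled. -/
noncomputable def derivX (K : Type*) [Field K] : Derivation K K[X][X] K[X][X] :=
  (Polynomial.derivative' (R := K[X])).restrictScalars K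

theorem derivX_apply (p : K[X][X]) : derivX K p = derivative p := rfl

theorem swap_liftX (p : K[X]) : Bivariate.swap (liftX p) = C p :=
  Bivariate.swap_map_C p

theorem exists_liftX_eq_of_degY_eq_zero {p : K[X][X]} (hp : degY p = 0) :
    ∃ q : K[X], liftX q = p := by
  rw [← natDegree_swap] at hp
  refine ⟨(Bivariate.swap p).coeff 0, (Bivariate.swap (R := K)).injective ?_⟩
  rw [swap_liftX, ← eq_C_of_natDegree_eq_zero hp]

theorem degY_mul {p q : K[X][X]} (hp : p ≠ 0) (hq : q ≠ 0) :
    degY (p * q) = degY p + degY q := by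
  simp only [← natDegree_swap, map_mul]
  exact natDegree_mul (by simpa using hp) (by simpa using hq)

theorem degY_liftX (p : K[X]) : degY (liftX p) = 0 := by
  rw [← natDegree_swap, swap_liftX, natDegree_C]

theorem degY_le_of_dvd {p q : K[X][X]} (hq : q ≠ 0) (h : p ∣ q) : degY p ≤ degY q := by
  obtain ⟨t, rfl⟩ := h
  rw [degY_mul (left_ne_zero_of_mul hq) (right_ne_zero_of_mul hq)]
  exact Nat.le_add_right _ _

theorem exists_prime_dvd_of_degY_pos (p : K[X][X]) (hp : 0 < degY p) :
    ∃ q, Prime q ∧ 0 < degY q ∧ q ∣ p := by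
  revert hp
  refine UniqueFactorizationMonoid.induction_on_prime p ?_ ?_ ?_
  · intro h
    simp [degY] at h
  · intro x hx h
    have := degY_le_of_dvd one_ne_zero hx.dvd (q := 1)
    rw [← natDegree_swap 1] at this
    simp at this
    omega
  · intro x q hx hq ih h
    rw [degY_mul hq.ne_zero hx] at h
    rcases Nat.eq_zero_or_pos (degY q) with h0 | h0
    · obtain ⟨q', h1, h2, h3⟩ := ih (by omega)
      exact ⟨q', h1, h2, h3.mul_left _⟩
    · exact ⟨q, hq, h0, dvd_mul_right _ _⟩

theorem DY_ne_zero [CharZero K] {p : K[X][X]} (hp : 0 < degY p) : DY p ≠ 0 := by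
  intro h
  have h1 := swap_DY p
  rw [h, map_zero] at h1
  have := derivative_eq_zero.mp h1.symm
  rw [natDegree_swap] at this
  omega

theorem not_dvd_DY [CharZero K] {p : K[X][X]} (hp : 0 < degY p) : ¬ p ∣ DY p := by
  intro h
  have h1 := degY_le_of_dvd (DY_ne_zero hp) h
  rw [← natDegree_swap (DY p), swap_DY] at h1
  have := natDegree_derivative_lt (p := Bivariate.swap p) (by rw [natDegree_swap]; omega)
  rw [natDegree_swap p] at this
  omega

end Swap

section DegreeBounds

variable {K : Type*} [Field K]

/-- The image of `f` under `g` has degree less than `N`; with `g` the identity this bounds the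
degree in `x`, with `g = Bivariate.swap` the degree in `y`. -/
def DegLT (g : K[X][X] →ₐ[K] K[X][X]) (f : K[X][X]) (N : ℕ) : Prop :=
  (g f).degree < (N : WithBot ℕ)

variable {g : K[X][X] →ₐ[K] K[X][X]} {f f' : K[X][X]} {M N : ℕ}

theorem DegLT.mono (h : DegLT g f M) (hMN : M ≤ N) : DegLT g f N :=
  lt_of_lt_of_le h (by exact_mod_cast hMN)

theorem DegLT.add (h : DegLT g f N) (h' : DegLT g f' N) : DegLT g (f + f') N := by
  unfold DegLT at *
  rw [map_add]
  exact lt_of_le_of_lt (degree_add_le _ _) (max_lt h h')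

theorem DegLT.sub (h : DegLT g f N) (h' : DegLT g f' N) : DegLT g (f - f') N := by
  unfold DegLT at *
  rw [map_sub]
  exact lt_of_le_of_lt (degree_sub_le _ _) (max_lt h h')

theorem degLT_zero : DegLT g (0 : K[X][X]) N := by
  unfold DegLT
  rw [map_zero, degree_zero]
  exact WithBot.bot_lt_coe N

theorem degLT_zero_iff (hg : Function.Injective g) : DegLT g f 0 ↔ f = 0 := by
  constructor
  · intro h
    unfold DegLT at h
    have : g f = 0 := by
      by_contra h0
      rw [degree_eq_natDegree h0] at h
      exact absurd (by exact_mod_cast h) (Nat.not_lt_zero _)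
    exact hg (by rw [this, map_zero])
  · rintro rfl
    exact degLT_zero

theorem degLT_succ_iff : DegLT g f (N + 1) ↔ (g f).natDegree ≤ N := by
  unfold DegLT
  rw [degree_lt_iff_coeff_zero, natDegree_le_iff_coeff_eq_zero]
  rfl

theorem DegLT.mul (h : DegLT g f (M + 1)) (h' : DegLT g f' N) : DegLT g (f * f') (M + N) := by
  rcases N with _ | N
  · unfold DegLT at *
    have h0 : g f' = 0 := by
      by_contra h0
      rw [degree_eq_natDegree h0] at h'
      exact absurd (by exact_mod_cast h') (Nat.not_lt_zero _)
    rw [map_mul, h0, mul_zero, degree_zero]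
    exact WithBot.bot_lt_coe _
  · rw [← add_assoc]
    rw [degLT_succ_iff] at *
    rw [map_mul]
    exact natDegree_mul_le.trans (add_le_add h h')

theorem DegLT.mul' (h : DegLT g f M) (h' : DegLT g f' (N + 1)) : DegLT g (f * f') (M + N) := by
  rw [mul_comm, add_comm]
  exact h'.mul h

theorem DegLT.pow (h : DegLT g f (M + 1)) (n : ℕ) : DegLT g (f ^ n) (n * M + 1) := by
  rw [degLT_succ_iff] at *
  rw [map_pow]
  exact natDegree_pow_le.trans (Nat.mul_le_mul_left _ h)

theorem DegLT.smul (k : K) (h : DegLT g f N) : DegLT g (k • f) N := by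
  unfold DegLT at *
  rw [map_smul]
  exact lt_of_le_of_lt (degree_smul_le _ _) h

theorem DegLT.natCast_mul (n : ℕ) (h : DegLT g f N) : DegLT g (n * f) N := by
  have : (n : K[X][X]) * f = (n : K) • f := by
    rw [Nat.cast_smul_eq_nsmul, nsmul_eq_mul]
  rw [this]
  exact h.smul _

theorem DegLT.sum {σ : Type*} {s : Finset σ} {F : σ → K[X][X]}
    (h : ∀ i ∈ s, DegLT g (F i) N) : DegLT g (∑ i ∈ s, F i) N := by
  classical
  induction s using Finset.induction_on with
  | empty => simpa using degLT_zero
  | insert i s hi ih =>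
    rw [Finset.sum_insert hi]
    exact (h i (mem_insert_self i s)).add (ih fun j hj => h j (mem_insert_of_mem hj))

theorem DegLT.prod {σ : Type*} {s : Finset σ} {F : σ → K[X][X]} {n : σ → ℕ}
    (h : ∀ i ∈ s, DegLT g (F i) (n i + 1)) : DegLT g (∏ i ∈ s, F i) (∑ i ∈ s, n i + 1) := by
  simp only [degLT_succ_iff, map_prod] at *
  exact (natDegree_prod_le _ _).trans (Finset.sum_le_sum h)

theorem degLT_natDegree (g : K[X][X] →ₐ[K] K[X][X]) (f : K[X][X]) :
    DegLT g f ((g f).natDegree + 1) :=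
  degLT_succ_iff.mpr le_rfl

theorem DegLT.of_mul (hg : Function.Injective g) (hf : f ≠ 0)
    (h : DegLT g (f * f') ((g f).natDegree + N)) : DegLT g f' N := by
  rcases eq_or_ne f' 0 with rfl | hf'
  · exact degLT_zero
  have h1 : g f ≠ 0 := (map_ne_zero_iff g hg).mpr hf
  have h2 : g f' ≠ 0 := (map_ne_zero_iff g hg).mpr hf'
  unfold DegLT at *
  rw [map_mul, degree_mul, degree_eq_natDegree h1, degree_eq_natDegree h2] at h
  rw [degree_eq_natDegree h2]
  have : (g f).natDegree + (g f').natDegree < (g f).natDegree + N := by exact_mod_cast h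
  exact_mod_cast (by omega : (g f').natDegree < N)

/-- The derivation `D` lowers the degree measured through `g` by at least `k`. -/
def LowersDeg (g : K[X][X] →ₐ[K] K[X][X]) (D : Derivation K K[X][X] K[X][X]) (k : ℕ) : Prop :=
  ∀ f n, DegLT g f (n + 1) → DegLT g (D f) (n + 1 - k)

/-- The degree measurement in `y`. -/
noncomputable def gY (K : Type*) [Field K] : K[X][X] →ₐ[K] K[X][X] :=
  (Bivariate.swap (R := K)).toAlgHom

/-- The degree measurement in `x`. -/
noncomputable def gX (K : Type*) [Field K] : K[X][X] →ₐ[K] K[X][X] := AlgHom.id K _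

theorem gX_apply (f : K[X][X]) : gX K f = f := rfl

theorem gY_apply (f : K[X][X]) : gY K f = Bivariate.swap f := rfl

theorem gX_injective : Function.Injective (gX K) := fun _ _ h => h

theorem gY_injective : Function.Injective (gY K) := (Bivariate.swap (R := K)).injective

theorem natDegree_gY (f : K[X][X]) : (gY K f).natDegree = degY f := natDegree_swap f

theorem lowersDeg_of_map_eq_derivative {D : Derivation K K[X][X] K[X][X]}
    (h : ∀ f, g (D f) = derivative (g f)) : LowersDeg g D 1 := by
  intro f n hf
  rw [degLT_succ_iff] at hf
  unfold DegLT
  rw [h, Nat.add_sub_cancel, degree_lt_iff_coeff_zero]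
  intro m hm
  rw [coeff_derivative, coeff_eq_zero_of_natDegree_lt (by omega), zero_mul]

theorem lowersDeg_gX_derivX : LowersDeg (gX K) (derivX K) 1 :=
  lowersDeg_of_map_eq_derivative fun _ => rfl

theorem lowersDeg_gY_derivY : LowersDeg (gY K) (derivY K) 1 :=
  lowersDeg_of_map_eq_derivative swap_DY

theorem lowersDeg_gX_derivY : LowersDeg (gX K) (derivY K) 0 := by
  intro f n hf
  rw [degLT_succ_iff] at hf
  unfold DegLT
  rw [gX_apply] at hf
  rw [gX_apply, derivY_apply, degree_lt_iff_coeff_zero]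
  intro m hm
  rw [coeff_DY, coeff_eq_zero_of_natDegree_lt (lt_of_le_of_lt hf (by omega)), derivative_zero]

theorem lowersDeg_gY_derivX : LowersDeg (gY K) (derivX K) 0 := by
  intro f n hf
  rw [degLT_succ_iff] at hf
  unfold DegLT
  rw [gY_apply] at hf
  rw [gY_apply, derivX_apply, degree_lt_iff_coeff_zero]
  intro m hm
  ext i
  rw [coeff_coeff_swap, coeff_derivative]
  have : ((i : K[X]) + 1) = C ((i : K) + 1) := by simp
  rw [this, coeff_mul_C, ← coeff_coeff_swap,
    coeff_eq_zero_of_natDegree_lt (lt_of_le_of_lt hf (by omega)), coeff_zero, zero_mul, coeff_zero]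

end DegreeBounds

section LogarithmicData

variable {K : Type*} [Field K]

/-- A polynomial `b` divides `D b * bs` as soon as every prime factor of `b` divides `bs`. -/
theorem dvd_derivation_mul (D : Derivation K K[X][X] K[X][X]) (b bs : K[X][X])
    (h : ∀ q : K[X][X], Prime q → q ∣ b → q ∣ bs) : b ∣ D b * bs := by
  revert h
  refine UniqueFactorizationMonoid.induction_on_prime b ?_ ?_ ?_
  · intro _
    simp
  · intro x hx _
    exact hx.dvd
  · intro x p _ hp ih h
    rw [Derivation.leibniz, smul_eq_mul, smul_eq_mul, add_mul]
    apply dvd_add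
    · rw [mul_assoc]
      exact mul_dvd_mul_left _ (ih fun q hq hqx => h q hq (hqx.mul_left p))
    · obtain ⟨t, ht⟩ := h p hp (dvd_mul_right p x)
      exact ⟨D p * t, by rw [ht]; ring⟩

variable {σ : Type*}

theorem degLT_denominator {g : K[X][X] →ₐ[K] K[X][X]} (c : σ → K[X][X]) (S : Finset σ) (b bs : K[X][X]) :
    DegLT g (b * bs * ∏ i ∈ S, c i)
      ((g b).natDegree + (g bs).natDegree + ∑ i ∈ S, (g (c i)).natDegree + 1) := by
  have h1 := (degLT_natDegree g b).mul (degLT_natDegree g bs)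
  rw [← add_assoc] at h1
  exact h1.mul (DegLT.prod fun i _ => degLT_natDegree g (c i))

variable [DecidableEq σ]

/-- The numerator of the logarithmic derivative of `∏ i ∈ S, c i ^ e i` over `∏ i ∈ S, c i`. -/
noncomputable def logNum (D : Derivation K K[X][X] K[X][X]) (c : σ → K[X][X]) (e : σ → K)
    (S : Finset σ) : K[X][X] :=
  ∑ i ∈ S, e i • (D (c i) * ∏ j ∈ S.erase i, c j)

theorem logNum_eq_add (D : Derivation K K[X][X] K[X][X]) (c : σ → K[X][X]) (e : σ → K)
    {S : Finset σ} {l : σ} (hl : l ∈ S) :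
    logNum D c e S = c l * logNum D c e (S.erase l) + e l • (D (c l) * ∏ j ∈ S.erase l, c j) := by
  unfold logNum
  rw [← Finset.add_sum_erase _ _ hl, add_comm, Finset.mul_sum]
  refine congrArg (· + _) (Finset.sum_congr rfl ?_)
  intro i hi
  have hi' := Finset.mem_erase.mp hi
  have hl' : l ∈ S.erase i := Finset.mem_erase.mpr ⟨hi'.1.symm, hl⟩
  rw [← Finset.mul_prod_erase _ _ hl', Finset.erase_right_comm, mul_smul_comm, mul_left_comm]

theorem dvd_logNum {D : Derivation K K[X][X] K[X][X]} {c : σ → K[X][X]} {e : σ → K}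
    {S : Finset σ} {p : K[X][X]} (hp : Prime p) (h : p ^ 2 ∣ ∏ i ∈ S, c i) :
    p ∣ logNum D c e S := by
  refine Finset.dvd_sum fun i hi => ?_
  rw [Algebra.smul_def]
  refine Dvd.dvd.mul_left ?_ _
  rw [← Finset.mul_prod_erase _ _ hi] at h
  by_cases h1 : p ∣ ∏ j ∈ S.erase i, c j
  · exact h1.mul_left _
  · have h2 : p ^ 2 ∣ c i := hp.pow_dvd_of_dvd_mul_right 2 h1 h
    obtain ⟨t, ht⟩ := h2
    refine Dvd.dvd.mul_right ?_ _
    rw [ht, Derivation.leibniz, Derivation.leibniz_pow]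
    simp only [smul_eq_mul, nsmul_eq_mul]
    exact ⟨p * D t + t * (2 * D p), by push_cast; ring⟩

variable {g : K[X][X] →ₐ[K] K[X][X]} {D : Derivation K K[X][X] K[X][X]} {k : ℕ}

theorem degLT_logNum (hk : k ≤ 1) (hD : LowersDeg g D k) (c : σ → K[X][X]) (e : σ → K)
    (S : Finset σ) :
    DegLT g (logNum D c e S) (∑ i ∈ S, (g (c i)).natDegree + 1 - k) := by
  refine DegLT.sum fun i hi => DegLT.smul _ ?_
  have h1 := hD _ _ (degLT_natDegree g (c i))
  have h2 : DegLT g (∏ j ∈ S.erase i, c j) (∑ j ∈ S.erase i, (g (c j)).natDegree + 1) :=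
    DegLT.prod fun j _ => degLT_natDegree g (c j)
  refine (h1.mul' h2).mono ?_
  rw [← Finset.add_sum_erase _ _ hi]
  omega

/-- The degree of the numerator `D a * bs - a * U` of `D (a / b)` over `b * bs`. -/
theorem degLT_exponent (hg : Function.Injective g) (hk : k ≤ 1) (hD : LowersDeg g D k)
    {a b bs U : K[X][X]} (hb : b ≠ 0) (hU : b * U = D b * bs) :
    DegLT g (D a * bs - a * U) ((g a).natDegree + (g bs).natDegree + 1 - k) := by
  have hU' : DegLT g U ((g bs).natDegree + 1 - k) := by
    refine DegLT.of_mul hg hb ?_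
    rw [hU]
    exact ((hD _ _ (degLT_natDegree g b)).mul' (degLT_natDegree g bs)).mono (by omega)
  refine DegLT.sub ?_ ?_
  · exact ((hD _ _ (degLT_natDegree g a)).mul' (degLT_natDegree g bs)).mono (by omega)
  · exact ((degLT_natDegree g a).mul hU').mono (by omega)

theorem degLT_numerator (hk : k ≤ 1) (hD : LowersDeg g D k) (c : σ → K[X][X]) (e : σ → K)
    (S : Finset σ) {T b bs : K[X][X]} {N : ℕ} (hT : DegLT g T N)
    (hN : (g b).natDegree + (g bs).natDegree + 1 - k ≤ N) :
    DegLT g (T * ∏ i ∈ S, c i + b * bs * logNum D c e S) (N + ∑ i ∈ S, (g (c i)).natDegree) := by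
  refine DegLT.add ?_ ?_
  · exact hT.mul' (DegLT.prod fun i _ => degLT_natDegree g (c i))
  · have h1 := (degLT_natDegree g b).mul (degLT_natDegree g bs)
    rw [← add_assoc] at h1
    exact (h1.mul (degLT_logNum hk hD c e S)).mono (by omega)

/-- If the leading coefficients of `a` and `b` are proportional over `K`, differentiating `a / b`
with respect to `y` lowers its degree in `x`. -/
theorem degLT_exponent_of_leadingCoeff {a b bs U : K[X][X]} (hb : b ≠ 0)
    (hU : b * U = DY b * bs) {κ : K} (hκ : a.leadingCoeff = C κ * b.leadingCoeff) :
    DegLT (gX K) (DY a * bs - a * U) (a.natDegree + bs.natDegree) := by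
  have hDY : ∀ f : K[X][X], (DY f).natDegree ≤ f.natDegree := fun f => by
    have := lowersDeg_gX_derivY _ _ (degLT_natDegree (gX K) f)
    rwa [Nat.sub_zero, degLT_succ_iff] at this
  have key : DegLT (gX K) (DY a * b - a * DY b) (a.natDegree + b.natDegree) := by
    unfold DegLT
    rw [gX_apply, degree_lt_iff_coeff_zero]
    intro m hm
    rcases hm.eq_or_lt with rfl | hm
    · rw [coeff_sub, coeff_mul_add_eq_of_natDegree_le (hDY a) le_rfl,
        coeff_mul_add_eq_of_natDegree_le le_rfl (hDY b), coeff_DY, coeff_DY]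
      change derivative a.leadingCoeff * b.leadingCoeff -
        a.leadingCoeff * derivative b.leadingCoeff = 0
      rw [hκ, derivative_C_mul]
      ring
    · apply coeff_eq_zero_of_natDegree_lt
      refine lt_of_le_of_lt (natDegree_sub_le _ _) (lt_of_le_of_lt ?_ hm)
      exact max_le (natDegree_mul_le.trans (Nat.add_le_add_right (hDY a) _))
        (natDegree_mul_le.trans (Nat.add_le_add_left (hDY b) _))
  refine DegLT.of_mul gX_injective hb ?_
  have h1 : b * (DY a * bs - a * U) = (DY a * b - a * DY b) * bs := by
    linear_combination (-a) * hU
  rw [h1]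
  exact (key.mul' (degLT_natDegree _ bs)).mono (by simp only [gX_apply]; omega)

end LogarithmicData

section Kernel

variable {K : Type*} [Field K]

/-- The numerator of `D_y (s * W ^ (1 - r) * H)` over `W ^ r`, relative to `H`, when
`D_y H = (F / W) * H`. -/
noncomputable def antiOp (W F : K[X][X]) (r : ℕ) (s : K[X][X]) : K[X][X] :=
  derivY K s * W + s * derivY K W + s * F - r * (s * derivY K W)

theorem antiOp_top_coeff {W F s : K[X][X]} {r : ℕ} (hF : DegLT (gY K) F (degY W)) (hs : s ≠ 0)
    (h : antiOp W F r s = 0) :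
    ((degY s : K[X]) + degY W - r * degY W) * (Bivariate.swap W).leadingCoeff
      + (X * Bivariate.swap F).coeff (degY W) = 0 := by
  have hX : ∀ f : K[X][X], (X * derivative f).natDegree ≤ f.natDegree ∧
      (X * derivative f).coeff f.natDegree = f.natDegree * f.leadingCoeff := by
    intro f
    constructor
    · rw [natDegree_le_iff_coeff_eq_zero]
      rintro (_ | N) hN
      · omega
      · rw [coeff_X_mul, coeff_derivative, coeff_eq_zero_of_natDegree_lt hN, zero_mul]
    · rw [leadingCoeff]
      rcases f.natDegree with _ | N
      · simp
      · rw [coeff_X_mul, coeff_derivative]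
        push_cast
        ring
  have hXF : (X * Bivariate.swap F).natDegree ≤ degY W := by
    rw [natDegree_le_iff_coeff_eq_zero]
    rintro (_ | N) hN
    · omega
    · rw [coeff_X_mul]
      exact (degree_lt_iff_coeff_zero _ _).mp hF N (by omega)
  have h1 : X * derivative (Bivariate.swap s) * Bivariate.swap W
      + Bivariate.swap s * (X * derivative (Bivariate.swap W))
      + Bivariate.swap s * (X * Bivariate.swap F)
      - (r : K[X][X]) * (Bivariate.swap s * (X * derivative (Bivariate.swap W))) = 0 := by
    have := congrArg (fun f => X * Bivariate.swap f) h
    simp only [antiOp, derivY_apply, map_add, map_sub, map_mul, map_natCast, map_zero, mul_zero,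
      swap_DY] at this
    linear_combination this
  have h2 := congrArg (fun f : K[X][X] => f.coeff ((Bivariate.swap s).natDegree +
    (Bivariate.swap W).natDegree)) h1
  rw [← natDegree_swap W] at hXF ⊢
  rw [← natDegree_swap s]
  have hr : (r : K[X][X]) = C (r : K[X]) := by simp
  simp only [hr, coeff_sub, coeff_add, coeff_C_mul, coeff_zero,
    coeff_mul_add_eq_of_natDegree_le (hX (Bivariate.swap s)).1 le_rfl,
    coeff_mul_add_eq_of_natDegree_le le_rfl (hX (Bivariate.swap W)).1,
    coeff_mul_add_eq_of_natDegree_le le_rfl hXF, (hX _).2] at h2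
  have hls : (Bivariate.swap s).leadingCoeff ≠ 0 := by simpa using hs
  apply mul_left_cancel₀ hls
  simp only [← leadingCoeff.eq_1] at h2
  linear_combination h2

theorem degY_eq_of_antiOp_eq_zero [CharZero K] {W F s t : K[X][X]} {r : ℕ} (hW : W ≠ 0)
    (hF : DegLT (gY K) F (degY W)) (hs : s ≠ 0) (h : antiOp W F r s = 0) (ht : t ≠ 0)
    (h' : antiOp W F r t = 0) : degY s = degY t := by
  have h1 := antiOp_top_coeff hF hs h
  have h2 := antiOp_top_coeff hF ht h'
  have hl : (Bivariate.swap W).leadingCoeff ≠ 0 := by simpa using hW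
  have h3 : ((degY s : K[X]) - degY t) * (Bivariate.swap W).leadingCoeff = 0 := by
    linear_combination h1 - h2
  have h4 := (mul_eq_zero.mp h3).resolve_right hl
  exact_mod_cast sub_eq_zero.mp h4

theorem exists_degY_set [CharZero K] {W F : K[X][X]} (r : ℕ) (hW : W ≠ 0)
    (hF : DegLT (gY K) F (degY W)) :
    ∃ J : Finset ℕ, J.card ≤ 1 ∧ ∀ s, s ≠ 0 → antiOp W F r s = 0 → degY s ∈ J := by
  by_cases hex : ∃ s, s ≠ 0 ∧ antiOp W F r s = 0
  · obtain ⟨t, ht, ht'⟩ := hex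
    refine ⟨{degY t}, by simp, fun s hs hs' => ?_⟩
    rw [Finset.mem_singleton]
    exact degY_eq_of_antiOp_eq_zero hW hF hs hs' ht ht'
  · exact ⟨∅, by simp, fun s hs hs' => (hex ⟨s, hs, hs'⟩).elim⟩

theorem mul_derivation_pow (D : Derivation K K[X][X] K[X][X]) (p : K[X][X]) (n : ℕ) :
    p * D (p ^ n) = n * p ^ n * D p := by
  rw [Derivation.leibniz_pow]
  rcases n with _ | n
  · simp
  · simp only [Nat.add_sub_cancel, nsmul_eq_mul, smul_eq_mul]
    ring

theorem pow_dvd_mul_derivation (D : Derivation K K[X][X] K[X][X]) {p f : K[X][X]} {n : ℕ}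
    (h : p ^ n ∣ f) : p ^ n ∣ p * D f := by
  obtain ⟨t, rfl⟩ := h
  refine ⟨p * D t + t * n * D p, ?_⟩
  rw [Derivation.leibniz, smul_eq_mul, smul_eq_mul]
  linear_combination t * mul_derivation_pow D p n

theorem exists_eq_pow_mul_of_prime {p f : K[X][X]} (hp : Prime p) (hf : f ≠ 0) :
    ∃ (n : ℕ) (t : K[X][X]), f = p ^ n * t ∧ ¬ p ∣ t := by
  obtain ⟨n, t, h1, h2⟩ := WfDvdMonoid.max_power_factor hf hp.irreducible
  exact ⟨n, t, h2, h1⟩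

theorem exponent_of_antiOp_eq_zero [CharZero K] {p cl V G s : K[X][X]} {e : K} {r : ℕ}
    (hp : Prime p) (hpY : 0 < degY p) (hpc : p ∣ cl) (hW : ¬ p ^ 2 ∣ cl * V) (hs : s ≠ 0)
    (h : antiOp (cl * V) (cl * G + e • (derivY K cl * V)) r s = 0) :
    ∃ n : ℕ, (n : K) + 1 - r + e = 0 := by
  obtain ⟨n, t, rfl, ht⟩ := exists_eq_pow_mul_of_prime hp hs
  obtain ⟨q, rfl⟩ := hpc
  have hq : ¬ p ∣ q * V := fun ⟨w, hw⟩ => hW ⟨w, by rw [mul_assoc, hw]; ring⟩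
  refine ⟨n, ?_⟩
  by_contra hne
  have hpow := mul_derivation_pow (derivY K) p n
  have hn : p ^ n ≠ 0 := pow_ne_zero _ hp.ne_zero
  have key : algebraMap K K[X][X] ((n : K) + 1 - r + e) * (derivY K p * t * (q * V)) =
      p * -(derivY K t * (q * V) + t * derivY K (q * V) + t * (q * G)
        + algebraMap K K[X][X] e * t * (derivY K q * V) - r * (t * derivY K (q * V))) := by
    apply mul_left_cancel₀ hn
    simp only [antiOp, Derivation.leibniz, smul_eq_mul] at h
    rw [Algebra.smul_def] at h
    simp only [Derivation.leibniz, smul_eq_mul, map_add, map_sub, map_natCast, map_one]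
    linear_combination h - t * q * V * hpow
  have hdvd : p ∣ derivY K p * t * (q * V) := by
    have h1 : p ∣ algebraMap K K[X][X] ((n : K) + 1 - r + e) * (derivY K p * t * (q * V)) := ⟨_, key⟩
    refine (hp.dvd_or_dvd h1).resolve_left fun h2 => ?_
    have hu : IsUnit (algebraMap K K[X][X] ((n : K) + 1 - r + e)) :=
      (isUnit_iff_ne_zero.mpr hne).map _
    exact hp.not_isUnit (isUnit_of_dvd_unit h2 hu)
  rcases hp.dvd_or_dvd hdvd with h1 | h1
  · rcases hp.dvd_or_dvd h1 with h2 | h2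
    · exact not_dvd_DY hpY h2
    · exact ht h2
  · exact hq h1

variable {σ : Type*}

theorem degY_prod {c : σ → K[X][X]} (hc : ∀ i, c i ≠ 0) (S : Finset σ) :
    degY (∏ i ∈ S, c i) = ∑ i ∈ S, degY (c i) := by
  simp only [← natDegree_swap, map_prod]
  exact natDegree_prod _ _ fun i _ => by simpa using hc i

variable [DecidableEq σ]

theorem pow_dvd_mul_logNum {D : Derivation K K[X][X] K[X][X]} {c : σ → K[X][X]} {e : σ → K}
    {S : Finset σ} {p B : K[X][X]} {w : ℕ} (hp : Prime p) (hc : ∀ i, c i ≠ 0)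
    (h : p ^ w ∣ B * ∏ i ∈ S, c i) : p ^ w ∣ p * (B * logNum D c e S) := by
  rw [logNum, Finset.mul_sum, Finset.mul_sum]
  refine Finset.dvd_sum fun i hi => ?_
  obtain ⟨v, t, h1, h2⟩ := exists_eq_pow_mul_of_prime hp (hc i)
  rw [← Finset.mul_prod_erase _ _ hi, h1] at h
  have h3 : p ^ w ∣ t * (p ^ v * (B * ∏ j ∈ S.erase i, c j)) := by
    convert h using 1; ring
  have h4 := hp.pow_dvd_of_dvd_mul_left w h2 h3
  obtain ⟨u, hu⟩ := pow_dvd_mul_derivation D (Dvd.intro t h1.symm : p ^ v ∣ c i)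
  obtain ⟨x, hx⟩ := h4
  refine ⟨x * u * algebraMap K _ (e i), ?_⟩
  rw [Algebra.smul_def]
  linear_combination B * algebraMap K _ (e i) * (∏ j ∈ S.erase i, c j) * hu
    + u * algebraMap K _ (e i) * hx

theorem degLT_logNum_denominator {c : σ → K[X][X]} (hc : ∀ i, c i ≠ 0) (e : σ → K)
    (S : Finset σ) {b bs : K[X][X]} (hb : b ≠ 0) (hbs : bs ≠ 0) :
    DegLT (gY K) (b * bs * logNum (derivY K) c e S) (degY (b * bs * ∏ i ∈ S, c i)) := by
  rw [degY_mul (mul_ne_zero hb hbs) (Finset.prod_ne_zero_iff.mpr fun i _ => hc i), degY_prod hc]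
  refine ((degLT_natDegree (gY K) (b * bs)).mul
    (degLT_logNum le_rfl lowersDeg_gY_derivY c e S)).mono ?_
  simp only [natDegree_gY]
  omega

/-- If `exp(a/b) * ∏ c ^ e` times a rational function is free of `y`, then so is `a / b`. -/
theorem exists_liftX_of_antiOp_eq_zero [CharZero K] {c : σ → K[X][X]} (hc : ∀ i, c i ≠ 0)
    {e : σ → K} {S : Finset σ} {a b bs U s : K[X][X]} {r : ℕ} (hb : b ≠ 0)
    (hbs : bs ≠ 0) (hU : b * U = derivY K b * bs) (hs : s ≠ 0)
    (h : antiOp (b * bs * ∏ i ∈ S, c i) ((derivY K a * bs - a * U) * ∏ i ∈ S, c i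
      + b * bs * logNum (derivY K) c e S) r s = 0) :
    ∃ a' b' : K[X], b' ≠ 0 ∧ a * liftX b' = b * liftX a' := by
  obtain ⟨a₁, b₁, z, hrel, haz, hbz⟩ :=
    UniqueFactorizationMonoid.exists_reduced_factors' a b hb
  have hz : z ≠ 0 := by rintro rfl; exact hb (by rw [← hbz, zero_mul])
  have hb₁ : b₁ ≠ 0 := by rintro rfl; exact hb (by rw [← hbz, mul_zero])
  have hP : ∏ i ∈ S, c i ≠ 0 := Finset.prod_ne_zero_iff.mpr fun i _ => hc i
  have hW : b * bs * ∏ i ∈ S, c i ≠ 0 := mul_ne_zero (mul_ne_zero hb hbs) hP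
  have hBn := degLT_logNum_denominator hc e S hb hbs
  have hpd := fun (p : K[X][X]) (w : ℕ) (hp : Prime p) => pow_dvd_mul_logNum
    (D := derivY K) (e := e) (S := S) (B := b * bs) (w := w) hp hc
  have hQ : b₁ ^ 2 * (derivY K a * bs - a * U)
      = b * bs * (derivY K a₁ * b₁ - a₁ * derivY K b₁) := by
    apply mul_left_cancel₀ hz
    have h1 : z * b₁ * U = (z * derivY K b₁ + b₁ * derivY K z) * bs := by
      have := hU
      rw [← hbz, Derivation.leibniz, smul_eq_mul, smul_eq_mul] at this
      exact this
    rw [← haz, ← hbz, Derivation.leibniz, smul_eq_mul, smul_eq_mul]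
    linear_combination (-z * a₁ * b₁) * h1
  set W := b * bs * ∏ i ∈ S, c i with hWdef
  set N := b * bs * logNum (derivY K) c e S with hNdef
  set Br := derivY K s * W + s * derivY K W + s * N - r * (s * derivY K W) with hBr
  have hmain : (derivY K a₁ * b₁ - a₁ * derivY K b₁) * (s * W) = - (b₁ ^ 2 * Br) := by
    unfold antiOp at h
    linear_combination b₁ ^ 2 * h - s * (∏ i ∈ S, c i) * hQ
      + s * (derivY K a₁ * b₁ - a₁ * derivY K b₁) * hWdef
  have hb₁Y : degY b₁ = 0 := by
    by_contra hne
    obtain ⟨p, hp, hpY, hpb⟩ := exists_prime_dvd_of_degY_pos b₁ (Nat.pos_of_ne_zero hne)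
    obtain ⟨n, s', hs', hps⟩ := exists_eq_pow_mul_of_prime hp hs
    obtain ⟨w, W', hW', hpW⟩ := exists_eq_pow_mul_of_prime hp hW
    obtain ⟨m, b', hb', hpb'⟩ := exists_eq_pow_mul_of_prime hp hb₁
    have hpa : ¬ p ∣ a₁ := fun h1 => hp.not_isUnit (hrel h1 hpb)
    have hm : m ≠ 0 := by
      rintro rfl
      rw [pow_zero, one_mul] at hb'
      exact hpb' (hb' ▸ hpb)
    obtain ⟨u₁, hu₁⟩ := pow_dvd_mul_derivation (derivY K) (Dvd.intro s' hs'.symm : p ^ n ∣ s)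
    obtain ⟨u₂, hu₂⟩ := pow_dvd_mul_derivation (derivY K) (Dvd.intro W' hW'.symm : p ^ w ∣ W)
    obtain ⟨u₃, hu₃⟩ := hpd p w hp (Dvd.intro W' hW'.symm)
    have hpBr : p * Br = p ^ n * p ^ w * (u₁ * W' + s' * u₂ + s' * u₃ - r * (s' * u₂)) := by
      rw [hBr]
      linear_combination W * hu₁ + (s - r * s) * hu₂ + s * hu₃ + p ^ n * u₁ * hW'
        + p ^ w * (u₂ + u₃ - r * u₂) * hs'
    have hpQ : p * (derivY K a₁ * b₁ - a₁ * derivY K b₁)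
        = p ^ m * (p * (derivY K a₁ * b' - a₁ * derivY K b') - m * (a₁ * b' * derivY K p)) := by
      have := mul_derivation_pow (derivY K) p m
      rw [hb', Derivation.leibniz, smul_eq_mul, smul_eq_mul]
      linear_combination (- a₁ * b') * this
    have h1 : (p * (derivY K a₁ * b' - a₁ * derivY K b') - m * (a₁ * b' * derivY K p)) * (s' * W')
        = p ^ m * - (b' ^ 2 * (u₁ * W' + s' * u₂ + s' * u₃ - r * (s' * u₂))) := by
      have hne : p ^ m * p ^ n * p ^ w ≠ 0 :=
        mul_ne_zero (mul_ne_zero (pow_ne_zero _ hp.ne_zero) (pow_ne_zero _ hp.ne_zero))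
          (pow_ne_zero _ hp.ne_zero)
      apply mul_left_cancel₀ hne
      have h2 : p * (derivY K a₁ * b₁ - a₁ * derivY K b₁) * (p ^ n * s' * (p ^ w * W'))
          = - ((p ^ m * b') ^ 2 * (p * Br)) := by
        rw [← hs', ← hW', ← hb']
        linear_combination p * hmain
      rw [hpQ, hpBr] at h2
      linear_combination h2
    have h2 : p ∣ (p * (derivY K a₁ * b' - a₁ * derivY K b') - m * (a₁ * b' * derivY K p))
        * (s' * W') := by
      rw [h1]
      exact (dvd_pow_self p hm).mul_right _
    have h3 : p ∣ (m : K[X][X]) * (a₁ * b' * derivY K p) := by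
      refine (dvd_sub_right (dvd_mul_right p _)).mp ((hp.dvd_or_dvd h2).resolve_right fun h3 => ?_)
      rcases hp.dvd_or_dvd h3 with h4 | h4
      · exact hps h4
      · exact hpW h4
    rcases hp.dvd_or_dvd h3 with h4 | h4
    · have hu : IsUnit (m : K[X][X]) := by
        have : (m : K[X][X]) = C (C (m : K)) := by simp
        rw [this]
        exact ((isUnit_iff_ne_zero.mpr (Nat.cast_ne_zero.mpr hm)).map C).map C
      exact hp.not_isUnit (isUnit_of_dvd_unit h4 hu)
    · rcases hp.dvd_or_dvd h4 with h5 | h5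
      · rcases hp.dvd_or_dvd h5 with h6 | h6
        · exact hpa h6
        · exact hpb' h6
      · exact not_dvd_DY hpY h5
  obtain ⟨β, hβ⟩ := exists_liftX_eq_of_degY_eq_zero hb₁Y
  have hlow := lowersDeg_gY_derivY (K := K)
  have hDb : derivY K b₁ = 0 := by
    have := hlow b₁ 0 (degLT_succ_iff.mpr (by rw [natDegree_gY, hb₁Y]))
    exact (degLT_zero_iff gY_injective).mp this
  have hDa : derivY K a₁ = 0 := by
    have h1 : s * W * derivY K a₁ = b₁ * - Br := by
      apply mul_left_cancel₀ hb₁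
      rw [hDb] at hmain
      linear_combination hmain
    have hds := degLT_natDegree (gY K) s
    have hdW := degLT_natDegree (gY K) W
    have hBrd : DegLT (gY K) Br (degY s + degY W) := by
      simp only [natDegree_gY] at hds hdW
      have hsW : DegLT (gY K) (s * derivY K W) (degY s + degY W) := hds.mul (hlow _ _ hdW)
      exact ((((hlow _ _ hds).mul' hdW).add hsW).add (hds.mul hBn)).sub (hsW.natCast_mul r)
    refine (degLT_zero_iff gY_injective).mp (DegLT.of_mul gY_injective (mul_ne_zero hs hW) ?_)
    rw [h1, natDegree_gY, degY_mul hs hW, add_zero]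
    have hb0 : DegLT (gY K) b₁ (0 + 1) := degLT_succ_iff.mpr (by rw [natDegree_gY, hb₁Y])
    have hneg : DegLT (gY K) (-Br) (degY s + degY W) := by
      simpa using degLT_zero.sub hBrd
    simpa using hb0.mul hneg
  have ha₁Y : degY a₁ = 0 := by
    by_contra hne
    exact DY_ne_zero (Nat.pos_of_ne_zero hne) hDa
  obtain ⟨α, hα⟩ := exists_liftX_eq_of_degY_eq_zero ha₁Y
  refine ⟨α, β, ?_, ?_⟩
  · rintro rfl
    exact hb₁ (by rw [← hβ, liftX, Polynomial.map_zero])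
  · rw [hα, hβ, ← haz, ← hbz]
    ring

theorem exponent_eq_zero_of_liftX {a b bs U : K[X][X]} (hb : b ≠ 0)
    (hU : b * U = derivY K b * bs) {a' b' : K[X]} (hb' : b' ≠ 0)
    (hab : a * liftX b' = b * liftX a') : derivY K a * bs - a * U = 0 := by
  have hlift : ∀ q : K[X], derivY K (liftX q) = 0 := fun q => by
    have := lowersDeg_gY_derivY (liftX q) 0
      (degLT_succ_iff.mpr (by rw [natDegree_gY, degY_liftX]))
    exact (degLT_zero_iff gY_injective).mp this
  have hD := congrArg (derivY K) hab
  rw [Derivation.leibniz, Derivation.leibniz, hlift, hlift] at hD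
  simp only [smul_eq_mul, mul_zero, zero_add] at hD
  have hb'' : liftX b' ≠ 0 := by
    intro h0
    have := congrArg Bivariate.swap h0
    rw [swap_liftX, map_zero] at this
    exact hb' (by simpa using this)
  have h0 : b * liftX b' * (derivY K a * bs - a * U) = 0 := by
    linear_combination b * bs * hD - bs * derivY K b * hab - a * liftX b' * hU
  exact (mul_eq_zero.mp h0).resolve_left (mul_ne_zero hb hb'')

end Kernel

section Counting

variable {K : Type*} [Field K]

/-- The `K`-linear embedding `liftX`. -/
noncomputable def liftXLinear (K : Type*) [Field K] : K[X] →ₗ[K] K[X][X] :=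
  (Polynomial.mapAlgHom (Polynomial.CAlgHom : K →ₐ[K] K[X])).toLinearMap

theorem liftXLinear_apply (p : K[X]) : liftXLinear K p = liftX p := rfl

/-- The polynomial with prescribed coefficients at `x ^ j * y ^ k`, for `j < m` and `k ∈ T`. -/
noncomputable def rectPoly (m : ℕ) (T : Finset ℕ) : (Fin m × T → K) →ₗ[K] K[X][X] where
  toFun f := ∑ j : Fin m, ∑ k : T, monomial (j : ℕ) (monomial (k : ℕ) (f (j, k)))
  map_add' f f' := by simp [Finset.sum_add_distrib]
  map_smul' κ f := by simp [Finset.smul_sum, smul_monomial]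

theorem coeff_coeff_rectPoly {m : ℕ} {T : Finset ℕ} (f : Fin m × T → K) (u v : ℕ) :
    ((rectPoly m T f).coeff u).coeff v =
      if h : u < m ∧ v ∈ T then f (⟨u, h.1⟩, ⟨v, h.2⟩) else 0 := by
  have h0 : ((rectPoly m T f).coeff u).coeff v = ∑ j : Fin m, ∑ k : T,
      if (j : ℕ) = u ∧ (k : ℕ) = v then f (j, k) else 0 := by
    rw [show rectPoly m T f = ∑ j : Fin m, ∑ k : T,
      monomial (j : ℕ) (monomial (k : ℕ) (f (j, k))) from rfl, finsetSum_coeff, finsetSum_coeff]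
    refine Finset.sum_congr rfl fun j _ => ?_
    rw [finsetSum_coeff, finsetSum_coeff]
    refine Finset.sum_congr rfl fun k _ => ?_
    rw [coeff_monomial]
    by_cases h1 : (j : ℕ) = u
    · simp [h1, coeff_monomial]
    · simp [h1]
  rw [h0]
  split_ifs with h
  · rw [Finset.sum_eq_single ⟨u, h.1⟩, Finset.sum_eq_single ⟨v, h.2⟩]
    · simp
    · rintro ⟨k, hk⟩ _ hne
      exact if_neg fun h1 => hne (Subtype.ext h1.2)
    · simp
    · rintro j _ hne
      refine Finset.sum_eq_zero fun k _ => if_neg fun h1 => hne (Fin.ext h1.1)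
    · simp
  · refine Finset.sum_eq_zero fun j _ => Finset.sum_eq_zero fun k _ => if_neg fun h1 => h ?_
    exact ⟨h1.1 ▸ j.2, h1.2 ▸ k.2⟩

theorem degLT_gX_iff {f : K[X][X]} {M : ℕ} :
    DegLT (gX K) f M ↔ ∀ u v, M ≤ u → (f.coeff u).coeff v = 0 := by
  unfold DegLT
  rw [degree_lt_iff_coeff_zero]
  constructor
  · intro h u v hu
    have := h u hu
    rw [gX_apply] at this
    rw [this, coeff_zero]
  · intro h u hu
    ext v
    exact h u v hu

theorem degLT_gY_iff {f : K[X][X]} {M : ℕ} :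
    DegLT (gY K) f M ↔ ∀ u v, M ≤ v → (f.coeff u).coeff v = 0 := by
  unfold DegLT
  rw [degree_lt_iff_coeff_zero]
  constructor
  · intro h u v hu
    rw [← coeff_coeff_swap]
    have := h v hu
    rw [gY_apply] at this
    rw [this, coeff_zero]
  · intro h v hv
    ext u
    rw [gY_apply, coeff_coeff_swap, coeff_zero]
    exact h u v hv

/-- The coefficients of a bivariate polynomial at `x ^ u * y ^ v` for `u < M` and `v < N`. -/
noncomputable def rectCoeff (M N : ℕ) : K[X][X] →ₗ[K] (Fin M × Fin N → K) where
  toFun f := fun uv => (f.coeff uv.1).coeff uv.2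
  map_add' f f' := by ext; simp
  map_smul' κ f := by ext; simp

theorem eq_zero_of_rectCoeff_eq_zero {M N : ℕ} {f : K[X][X]} (hX : DegLT (gX K) f M)
    (hY : DegLT (gY K) f N) (h : rectCoeff M N f = 0) : f = 0 := by
  ext u v
  rcases lt_or_ge u M with hu | hu
  · rcases lt_or_ge v N with hv | hv
    · exact congrFun h (⟨u, hu⟩, ⟨v, hv⟩)
    · exact degLT_gY_iff.mp hY u v hv
  · exact degLT_gX_iff.mp hX u v hu

theorem exists_relation_of_count {r M N mx my : ℕ} {m : ℕ → ℕ} {J : Finset ℕ}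
    {G : ℕ → K[X][X]} (A : K[X][X] →ₗ[K] K[X][X])
    (hG : ∀ i ≤ r, ∀ p : K[X], p.degree < (m i : WithBot ℕ) →
      DegLT (gX K) (liftX p * G i) M ∧ DegLT (gY K) (liftX p * G i) N)
    (hA : ∀ s, DegLT (gX K) s mx → DegLT (gY K) s my →
      DegLT (gX K) (A s) M ∧ DegLT (gY K) (A s) N)
    (hker : ∀ s, s ≠ 0 → A s = 0 → degY s ∈ J)
    (hcount : M * N < ∑ i ∈ Finset.range (r + 1), m i + mx * (my - J.card)) :
    ∃ (p : ℕ → K[X]) (s : K[X][X]), (∃ i ≤ r, p i ≠ 0) ∧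
      (∀ i ≤ r, (p i).degree < (m i : WithBot ℕ)) ∧
      ∑ i ∈ Finset.range (r + 1), liftX (p i) * G i = A s := by
  classical
  set T : Finset ℕ := Finset.range my \ J with hT
  let V := ((i : Fin (r + 1)) → degreeLT K (m i)) × (Fin mx × T → K)
  let Ψ : V →ₗ[K] K[X][X] :=
    (∑ i : Fin (r + 1), (LinearMap.mulRight K (G i)) ∘ₗ (liftXLinear K) ∘ₗ
      (degreeLT K (m i)).subtype ∘ₗ (LinearMap.proj i)) ∘ₗ (LinearMap.fst K _ _)
    - A ∘ₗ rectPoly mx T ∘ₗ (LinearMap.snd K _ _)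
  have hΨ : ∀ v : V, Ψ v = ∑ i : Fin (r + 1), liftX (v.1 i : K[X]) * G i - A (rectPoly mx T v.2) := by
    intro v
    simp [Ψ, liftXLinear_apply]
    rfl
  have hfin : ∀ n : ℕ, FiniteDimensional K (degreeLT K n) := fun n =>
    (degreeLTEquiv K n).symm.finiteDimensional
  have hfr : ∀ n : ℕ, Module.finrank K (degreeLT K n) = n := fun n => by
    rw [(degreeLTEquiv K n).finrank_eq, Module.finrank_fin_fun]
  have hcard : Module.finrank K (Fin M × Fin N → K) < Module.finrank K V := by
    rw [Module.finrank_prod, Module.finrank_fintype_fun_eq_card,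
      Module.finrank_fintype_fun_eq_card, Module.finrank_pi_fintype]
    simp only [hfr, Fintype.card_prod, Fintype.card_fin, Fintype.card_coe]
    rw [Fin.sum_univ_eq_sum_range]
    refine lt_of_lt_of_le hcount (Nat.add_le_add_left (Nat.mul_le_mul_left _ ?_) _)
    have := Finset.le_card_sdiff J (Finset.range my)
    rwa [Finset.card_range] at this
  have hne := LinearMap.ker_ne_bot_of_finrank_lt (f := rectCoeff M N ∘ₗ Ψ) hcard
  obtain ⟨v, hv, hv0⟩ := (Submodule.ne_bot_iff _).mp hne
  have hsX : DegLT (gX K) (rectPoly mx T v.2) mx := degLT_gX_iff.mpr fun u w hu => by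
    rw [coeff_coeff_rectPoly, dif_neg (by omega)]
  have hsY : DegLT (gY K) (rectPoly mx T v.2) my := degLT_gY_iff.mpr fun u w hw => by
    rw [coeff_coeff_rectPoly, dif_neg]
    rintro ⟨_, h2⟩
    rw [hT, Finset.mem_sdiff, Finset.mem_range] at h2
    omega
  have hpd : ∀ i : Fin (r + 1), ((v.1 i : K[X])).degree < (m i : WithBot ℕ) := fun i =>
    mem_degreeLT.mp (v.1 i).2
  have hGv := fun i : Fin (r + 1) => hG i (Nat.lt_succ_iff.mp i.2) _ (hpd i)
  have hΨ0 : Ψ v = 0 := by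
    have hg := hA _ hsX hsY
    refine eq_zero_of_rectCoeff_eq_zero (M := M) (N := N) ?_ ?_ hv
    · rw [hΨ]
      exact (DegLT.sum fun (i : Fin (r + 1)) _ => (hGv i).1).sub hg.1
    · rw [hΨ]
      exact (DegLT.sum fun (i : Fin (r + 1)) _ => (hGv i).2).sub hg.2
  rw [hΨ, sub_eq_zero] at hΨ0
  let p : ℕ → K[X] := fun i => if h : i < r + 1 then (v.1 ⟨i, h⟩ : K[X]) else 0
  have hp : ∀ i : Fin (r + 1), p i = v.1 i := fun i => dif_pos i.2
  refine ⟨p, rectPoly mx T v.2, ?_, ?_, ?_⟩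
  · by_contra hall
    push Not at hall
    have hv1 : v.1 = 0 := by
      funext i
      apply Subtype.ext
      rw [← hp i, hall i (Nat.lt_succ_iff.mp i.2)]
      rfl
    have hs0 : rectPoly mx T v.2 = 0 := by
      by_contra hs0
      have h1 : A (rectPoly mx T v.2) = 0 := by
        rw [← hΨ0, hv1]
        refine Finset.sum_eq_zero fun i _ => ?_
        simp [liftX]
      have h2 := hker _ hs0 h1
      have h3 : (Bivariate.swap (rectPoly mx T v.2)).leadingCoeff = 0 := by
        ext u
        rw [leadingCoeff, coeff_coeff_swap, natDegree_swap, coeff_coeff_rectPoly, dif_neg]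
        · simp
        · rintro ⟨_, h3⟩
          exact (Finset.mem_sdiff.mp h3).2 h2
      exact hs0 (by simpa using h3)
    have hv2 : v.2 = 0 := by
      funext ⟨j, k⟩
      have := coeff_coeff_rectPoly v.2 j k
      rw [hs0, dif_pos ⟨j.2, k.2⟩] at this
      simpa using this.symm
    exact hv0 (Prod.ext hv1 hv2)
  · intro i hi
    have := hpd ⟨i, Nat.lt_succ_iff.mpr hi⟩
    rwa [← hp] at this
  · rw [← hΨ0, ← Fin.sum_univ_eq_sum_range (fun i => liftX (p i) * G i)]
    exact Finset.sum_congr rfl fun i _ => by rw [hp]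

end Counting

section Telescoper

variable {K : Type*} [Field K]

theorem antiOp_add (W F : K[X][X]) (r : ℕ) (s s' : K[X][X]) :
    antiOp W F r (s + s') = antiOp W F r s + antiOp W F r s' := by
  simp only [antiOp, map_add]
  ring

theorem antiOp_smul (W F : K[X][X]) (r : ℕ) (κ : K) (s : K[X][X]) :
    antiOp W F r (κ • s) = κ • antiOp W F r s := by
  unfold antiOp
  rw [Derivation.map_smul]
  simp only [Algebra.smul_def]
  ring

/-- The map `antiOp W F r` is `K`-linear. -/
noncomputable def antiOpLinear (W F : K[X][X]) (r : ℕ) : K[X][X] →ₗ[K] K[X][X] where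
  toFun := antiOp W F r
  map_add' := antiOp_add W F r
  map_smul' := antiOp_smul W F r

theorem degLT_gX_antiOp {W F s : K[X][X]} {r m B : ℕ} (hW : DegLT (gX K) W (B + 1))
    (hF : DegLT (gX K) F (B + 1)) (hs : DegLT (gX K) s m) :
    DegLT (gX K) (antiOp W F r s) (m + B) := by
  have hDW : DegLT (gX K) (derivY K W) (B + 1) := lowersDeg_gX_derivY _ _ hW
  have hDs : DegLT (gX K) (derivY K s) m := by
    rcases m with _ | m
    · rw [degLT_zero_iff gX_injective] at hs
      rw [hs, map_zero]
      exact degLT_zero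
    · exact lowersDeg_gX_derivY _ _ hs
  exact (((hDs.mul' hW).add (hs.mul' hDW)).add (hs.mul' hF)).sub ((hs.mul' hDW).natCast_mul _)

theorem degLT_gY_antiOp {W F s : K[X][X]} {r n γ : ℕ} (hW : DegLT (gY K) W (γ + 1))
    (hF : DegLT (gY K) F γ) (hs : DegLT (gY K) s (n + 1)) :
    DegLT (gY K) (antiOp W F r s) (n + γ) := by
  have hDW : DegLT (gY K) (derivY K W) γ := lowersDeg_gY_derivY _ _ hW
  have hDs : DegLT (gY K) (derivY K s) n := lowersDeg_gY_derivY _ _ hs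
  exact (((hDs.mul' hW).add (hs.mul hDW)).add (hs.mul hF)).sub ((hs.mul hDW).natCast_mul _)

/-- The numerators of the iterated derivatives of `c * H` over the powers of `W`, relative to `H`,
when `D_x H = (F / W) * H`. -/
noncomputable def derivNum (W F c : K[X][X]) : ℕ → K[X][X]
  | 0 => c
  | i + 1 => derivX K (derivNum W F c i) * W + derivNum W F c i * F
      - i * (derivNum W F c i * derivX K W)

theorem degLT_gX_derivNum {W F c : K[X][X]} {α β C : ℕ} (hW : DegLT (gX K) W (α + 1))
    (hF : DegLT (gX K) F (α + β + 1)) (hc : DegLT (gX K) c (C + 1)) (i : ℕ) :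
    DegLT (gX K) (derivNum W F c i) (C + i * (α + β) + 1) := by
  induction i with
  | zero => simpa [derivNum] using hc
  | succ i ih =>
    have hDW : DegLT (gX K) (derivX K W) α := lowersDeg_gX_derivX _ _ hW
    have hDN : DegLT (gX K) (derivX K (derivNum W F c i)) (C + i * (α + β)) :=
      lowersDeg_gX_derivX _ _ ih
    rw [derivNum, add_one_mul]
    exact (((hDN.mul' hW).mono (by omega)).add ((ih.mul hF).mono (by omega))).sub
      (((ih.mul hDW).natCast_mul _).mono (by omega))

theorem degLT_gY_derivNum {W F c : K[X][X]} {γ Y : ℕ} (hW : DegLT (gY K) W (γ + 1))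
    (hF : DegLT (gY K) F (γ + 1)) (hc : DegLT (gY K) c (Y + 1)) (i : ℕ) :
    DegLT (gY K) (derivNum W F c i) (Y + i * γ + 1) := by
  induction i with
  | zero => simpa [derivNum] using hc
  | succ i ih =>
    have hDW : DegLT (gY K) (derivX K W) (γ + 1) := lowersDeg_gY_derivX _ _ hW
    have hDN : DegLT (gY K) (derivX K (derivNum W F c i)) (Y + i * γ + 1) :=
      lowersDeg_gY_derivX _ _ ih
    rw [derivNum, add_one_mul, ← add_assoc]
    exact ((hDN.mul hW).add (ih.mul hF)).sub ((ih.mul hDW).natCast_mul _)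

theorem degLT_gX_liftX {p : K[X]} {m : ℕ} (h : p.degree < (m : WithBot ℕ)) :
    DegLT (gX K) (liftX p) m := by
  refine degLT_gX_iff.mpr fun u v hu => ?_
  rw [liftX, coeff_map, coeff_eq_zero_of_degree_lt (h.trans_le (by exact_mod_cast hu)), map_zero,
    coeff_zero]

theorem degLT_gY_liftX (p : K[X]) : DegLT (gY K) (liftX p) 1 :=
  degLT_succ_iff.mpr (by rw [natDegree_gY, degY_liftX])

variable {E : Type*} [Field E] {Dx Dy : E → E} {ι : K[X][X] →+* E}

theorem iterate_mul_pow_eq (hDxmul : ∀ u v : E, Dx (u * v) = Dx u * v + u * Dx v)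
    (hinj : Function.Injective ι) (hDxι : ∀ q : K[X][X], Dx (ι q) = ι (derivative q))
    {W F c : K[X][X]} (hW : W ≠ 0) {H : E} (hH : Dx H * ι W = ι F * H) (i : ℕ) :
    Dx^[i] (ι c * H) * ι W ^ i = ι (derivNum W F c i) * H := by
  have hW' : ι W ≠ 0 := (map_ne_zero_iff ι hinj).mpr hW
  induction i with
  | zero => simp [derivNum]
  | succ i ih =>
    have h1 := congrArg Dx ih
    rw [← map_pow, hDxmul, hDxmul, hDxι, hDxι, map_pow] at h1
    have h2 := congrArg ι (mul_derivation_pow (derivX K) W i)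
    simp only [map_mul, map_pow, map_natCast, derivX_apply] at h2
    rw [Function.iterate_succ_apply']
    simp only [derivNum, map_sub, map_add, map_mul, map_natCast, derivX_apply]
    linear_combination ι W * h1 - Dx^[i] (ι c * H) * h2
      - i * ι (derivative W) * ih + ι (derivNum W F c i) * hH

theorem deriv_div_mul_pow_eq (hDymul : ∀ u v : E, Dy (u * v) = Dy u * v + u * Dy v)
    (hinj : Function.Injective ι) (hDyι : ∀ q : K[X][X], Dy (ι q) = ι (DY q))
    {W F c s : K[X][X]} (hW : W ≠ 0) (hc : c ≠ 0) {H : E} (hH : Dy H * ι W = ι F * H) (r : ℕ) :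
    Dy (ι (s * W) * (ι c * H) / ι (c * W ^ r)) * ι W ^ r = ι (antiOp W F r s) * H := by
  have hW' : ι W ≠ 0 := (map_ne_zero_iff ι hinj).mpr hW
  have hc' : ι c ≠ 0 := (map_ne_zero_iff ι hinj).mpr hc
  set z := ι (s * W) * (ι c * H) / ι (c * W ^ r) with hz
  have h0 : z * ι (W ^ r) = ι (s * W) * H := by
    rw [hz, map_mul ι c]
    have : ι (W ^ r) ≠ 0 := by rw [map_pow]; exact pow_ne_zero _ hW'
    field_simp
  have h1 := congrArg Dy h0
  rw [hDymul, hDymul, hDyι, hDyι, map_pow] at h1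
  have h2 := congrArg ι (mul_derivation_pow (derivY K) W r)
  have h3 : DY (s * W) = s * DY W + W * DY s := (derivY K).leibniz s W
  simp only [map_mul, map_pow, map_natCast, derivY_apply] at h2 h0
  rw [h3] at h1
  simp only [map_mul, map_add] at h1
  refine mul_right_cancel₀ hW' ?_
  simp only [antiOp, map_sub, map_add, map_mul, map_natCast, derivY_apply]
  linear_combination ι W * h1 - z * h2 - r * ι (DY W) * h0 + ι s * ι W * hH

theorem two_mul_sum_range_sub (q t : ℕ) :
    2 * ∑ i ∈ Finset.range (q + t + 1), (i - q) = t * (t + 1) := by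
  induction t with
  | zero =>
    rw [Finset.sum_eq_zero fun i hi => by rw [Finset.mem_range] at hi; omega]
    simp
  | succ t ih =>
    rw [← add_assoc, Finset.sum_range_succ, mul_add, ih, show q + t + 1 - q = t + 1 by omega]
    ring

theorem le_two_mul_sum_range (q t d β : ℕ) :
    2 * ((q + t + 1 : ℤ) * (d + 1)) - β * (t * (t + 1)) ≤
      2 * ∑ i ∈ Finset.range (q + t + 1), ((min (d + 1) (d + 1 + q * β - i * β) : ℕ) : ℤ) := by
  have h1 : ∀ i ∈ Finset.range (q + t + 1), (d + 1 : ℤ) - β * ((i - q : ℕ) : ℤ) ≤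
      ((min (d + 1) (d + 1 + q * β - i * β) : ℕ) : ℤ) := by
    intro i _
    rcases le_total i q with hi | hi
    · have := Nat.mul_le_mul_right β hi
      rw [Nat.sub_eq_zero_of_le hi, min_eq_left (by omega)]
      push_cast
      omega
    · obtain ⟨k, rfl⟩ := Nat.exists_eq_add_of_le hi
      rw [Nat.add_sub_cancel_left, add_mul, mul_comm k β]
      have : ((β * k : ℕ) : ℤ) = (β : ℤ) * k := by push_cast; rfl
      rw [← this]
      omega
  have h2 := Finset.sum_le_sum h1
  rw [Finset.sum_sub_distrib, ← Finset.mul_sum, Finset.sum_const, Finset.card_range,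
    ← Nat.cast_sum, nsmul_eq_mul] at h2
  have h3 : (2 : ℤ) * ((∑ i ∈ Finset.range (q + t + 1), (i - q) : ℕ) : ℤ) = t * (t + 1) := by
    exact_mod_cast two_mul_sum_range_sub q t
  push_cast at h2 h3 ⊢
  linear_combination 2 * h2 + (β : ℤ) * h3

/-- Existence of a creative telescoping relation for `c * H`, where
`D_x H = (Fx / W) * H` and `D_y H = (Fy / W) * H`, by counting unknowns and equations. -/
theorem exists_telescoper (hDxmul : ∀ u v : E, Dx (u * v) = Dx u * v + u * Dx v)
    (hDymul : ∀ u v : E, Dy (u * v) = Dy u * v + u * Dy v)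
    (hinj : Function.Injective ι) (hDxι : ∀ q : K[X][X], Dx (ι q) = ι (derivative q))
    (hDyι : ∀ q : K[X][X], Dy (ι q) = ι (DY q))
    {W Fx Fy c : K[X][X]} (hW : W ≠ 0) (hc : c ≠ 0) {H : E}
    (hHx : Dx H * ι W = ι Fx * H) (hHy : Dy H * ι W = ι Fy * H)
    {α β γ C Y B r t d j : ℕ} {J : Finset ℕ}
    (hWX : DegLT (gX K) W (α + 1)) (hFxX : DegLT (gX K) Fx (α + β + 1))
    (hWB : DegLT (gX K) W (B + 1)) (hFyB : DegLT (gX K) Fy (B + 1))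
    (hWY : DegLT (gY K) W (γ + 1)) (hFxY : DegLT (gY K) Fx (γ + 1)) (hFyY : DegLT (gY K) Fy γ)
    (hcX : DegLT (gX K) c (C + 1)) (hcY : DegLT (gY K) c (Y + 1))
    (hJ : J.card ≤ j) (hker : ∀ s, s ≠ 0 → antiOp W Fy r s = 0 → degY s ∈ J)
    (htr : t ≤ r) (hγ : γ + j ≤ Y + r * γ + 1)
    (hcount : 0 < 2 * ((r + 1 : ℤ) * (d + 1)) - β * (t * (t + 1))
      - 2 * ((d + 1 + C + r * α + (r - t) * β) * (γ + j - 1)) - 2 * (B * (Y + r * γ + 2 - γ - j))) :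
    ∃ p : ℕ → K[X], (∃ i ≤ r, p i ≠ 0) ∧ (∀ i ≤ r, (p i).natDegree ≤ d) ∧
      ∃ u v : K[X][X], v ≠ 0 ∧
        ∑ i ∈ Finset.range (r + 1), ι (liftX (p i)) * Dx^[i] (ι c * H)
          = Dy (ι u * (ι c * H) / ι v) := by
  obtain ⟨q, rfl⟩ := Nat.exists_eq_add_of_le' htr
  set r := q + t with hr
  refine Exists.elim (exists_relation_of_count (r := r) (J := J)
    (M := d + 1 + C + r * α + q * β) (N := Y + r * γ + 1) (mx := d + 1 + C + r * α + q * β - B)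
    (my := Y + r * γ + 1 - γ + 1) (m := fun i => min (d + 1) (d + 1 + q * β - i * β))
    (G := fun i => derivNum W Fx c i * W ^ (r - i)) (antiOpLinear W Fy r) ?_ ?_ hker ?_) ?_
  · intro i hi p hp
    constructor
    · rcases Nat.eq_zero_or_pos (min (d + 1) (d + 1 + q * β - i * β)) with h0 | h0
      · rw [h0] at hp
        rw [(degLT_zero_iff gX_injective).mp (degLT_gX_liftX hp), zero_mul]
        exact degLT_zero
      · have h1 : DegLT (gX K) (derivNum W Fx c i * W ^ (r - i))
            (C + i * (α + β) + (r - i) * α + 1) :=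
          (degLT_gX_derivNum hWX hFxX hcX i).mul (hWX.pow (r - i))
        refine ((degLT_gX_liftX hp).mul' h1).mono ?_
        obtain ⟨k, hk⟩ := Nat.exists_eq_add_of_le hi
        rw [hk, Nat.add_sub_cancel_left, mul_add, add_mul]
        omega
    · have h1 := (degLT_gY_liftX p).mul
        ((degLT_gY_derivNum hWY hFxY hcY i).mul (hWY.pow (r - i)))
      refine h1.mono ?_
      obtain ⟨k, hk⟩ := Nat.exists_eq_add_of_le hi
      rw [hk, Nat.add_sub_cancel_left, add_mul]
      omega
  · intro s hsX hsY
    constructor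
    · rcases Nat.eq_zero_or_pos (d + 1 + C + r * α + q * β - B) with h0 | h0
      · rw [h0, degLT_zero_iff gX_injective] at hsX
        rw [hsX, map_zero]
        exact degLT_zero
      · exact (degLT_gX_antiOp hWB hFyB hsX).mono (by omega)
    · exact (degLT_gY_antiOp hWY hFyY hsY).mono (by omega)
  · have h1 := le_two_mul_sum_range q t d β
    have h2 : ((d + 1 + C + r * α + q * β : ℕ) : ℤ) - B ≤
      ((d + 1 + C + r * α + q * β - B : ℕ) : ℤ) := by omega
    have h3 : ((Y + r * γ + 2 : ℕ) : ℤ) - γ - j ≤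
      ((Y + r * γ + 1 - γ + 1 - J.card : ℕ) : ℤ) := by omega
    have h4 : 0 ≤ ((Y + r * γ + 2 : ℕ) : ℤ) - γ - j := by omega
    have h5 := mul_le_mul_of_nonneg_right h2 h4
    have h6 := mul_le_mul_of_nonneg_left h3
      (Int.natCast_nonneg (d + 1 + C + r * α + q * β - B))
    have h7 := h5.trans h6
    rw [← Nat.cast_lt (α := ℤ), Nat.cast_add, Nat.cast_mul (_ - B), Nat.cast_sum]
    have h8 : (r : ℤ) = q + t := by rw [hr]; push_cast; rfl
    push_cast at h1 h7 hcount ⊢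
    rw [h8] at hcount h7 ⊢
    rw [add_sub_cancel_right] at hcount
    linarith
  · rintro p ⟨s, hp0, hpd, hps⟩
    refine ⟨p, hp0, fun i hi => ?_, s * W, c * W ^ r, mul_ne_zero hc (pow_ne_zero _ hW), ?_⟩
    · have h1 := (hpd i hi).trans_le (Nat.cast_le.mpr (min_le_left _ _))
      exact natDegree_le_of_degree_le (Order.lt_succ_iff.mp (by exact_mod_cast h1))
    · have hW' : ι W ≠ 0 := (map_ne_zero_iff ι hinj).mpr hW
      refine mul_right_cancel₀ (pow_ne_zero r hW') ?_
      rw [deriv_div_mul_pow_eq hDymul hinj hDyι hW hc hHy, Finset.sum_mul,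
        show antiOp W Fy r s = _ from hps.symm, map_sum, Finset.sum_mul]
      refine Finset.sum_congr rfl fun i hi => ?_
      have h1 := iterate_mul_pow_eq hDxmul hinj hDxι hW (c := c) hHx i
      rw [← Nat.sub_add_cancel (Nat.lt_succ_iff.mp (Finset.mem_range.mp hi)), pow_add,
        Nat.sub_add_cancel (Nat.lt_succ_iff.mp (Finset.mem_range.mp hi))]
      simp only [map_mul, map_pow]
      linear_combination ι (liftX (p i)) * ι W ^ (r - i) * h1

end Telescoper

section StandardForm

variable {K : Type*} [Field K] {σ : Type*}

/-- The denominator of the logarithmic derivatives of `exp (a / b) * ∏ i ∈ S, c i ^ e i`. -/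
noncomputable def logDen (b bs : K[X][X]) (c : σ → K[X][X]) (S : Finset σ) : K[X][X] :=
  b * bs * ∏ i ∈ S, c i

theorem logDen_ne_zero {b bs : K[X][X]} {c : σ → K[X][X]} (hb : b ≠ 0) (hbs : bs ≠ 0)
    (hc : ∀ i, c i ≠ 0) (S : Finset σ) : logDen b bs c S ≠ 0 :=
  mul_ne_zero (mul_ne_zero hb hbs) (Finset.prod_ne_zero_iff.mpr fun i _ => hc i)

theorem degLT_gX_logDen {b bs : K[X][X]} (c : σ → K[X][X]) {S : Finset σ} {α : ℕ}
    (hα : b.natDegree + bs.natDegree + ∑ i ∈ S, (c i).natDegree = α) :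
    DegLT (gX K) (logDen b bs c S) (α + 1) :=
  hα ▸ degLT_denominator c S b bs

theorem degLT_gY_logDen {a b bs : K[X][X]} (c : σ → K[X][X]) {S : Finset σ} {γ : ℕ}
    (hγ : degY bs + max (degY a) (degY b) + ∑ i ∈ S, degY (c i) = γ) :
    DegLT (gY K) (logDen b bs c S) (γ + 1) := by
  refine (degLT_denominator c S b bs).mono ?_
  simp only [natDegree_gY]
  omega

variable [DecidableEq σ]

/-- The numerator over `logDen b bs c S` of the logarithmic derivative of
`exp (a / b) * ∏ i ∈ S, c i ^ e i`, where `b * U = D b * bs`. -/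
noncomputable def expNum (D : Derivation K K[X][X] K[X][X]) (a b bs U : K[X][X])
    (c : σ → K[X][X]) (e : σ → K) (S : Finset σ) : K[X][X] :=
  (D a * bs - a * U) * ∏ i ∈ S, c i + b * bs * logNum D c e S

theorem logDen_eq_mul (b bs : K[X][X]) (c : σ → K[X][X]) {S : Finset σ} {l : σ} (hl : l ∈ S) :
    logDen b bs c S = c l * logDen b bs c (S.erase l) := by
  rw [logDen, logDen, ← Finset.mul_prod_erase _ _ hl]
  ring

theorem expNum_eq_add (D : Derivation K K[X][X] K[X][X]) (a b bs U : K[X][X])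
    (c : σ → K[X][X]) (e : σ → K) {S : Finset σ} {l : σ} (hl : l ∈ S) :
    expNum D a b bs U c e S = c l * expNum D a b bs U c e (S.erase l)
      + e l • (D (c l) * logDen b bs c (S.erase l)) := by
  rw [expNum, expNum, logDen, logNum_eq_add D c e hl, ← Finset.mul_prod_erase _ _ hl]
  simp only [Algebra.smul_def]
  ring

variable {a b bs U : K[X][X]}

theorem degLT_gX_expNum_derivX (hb : b ≠ 0) (hU : b * U = derivX K b * bs) {α β : ℕ}
    (c : σ → K[X][X]) (e : σ → K) {S : Finset σ} (hβ : a.natDegree = b.natDegree + β + 1)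
    (hα : b.natDegree + bs.natDegree + ∑ i ∈ S, (c i).natDegree = α) :
    DegLT (gX K) (expNum (derivX K) a b bs U c e S) (α + β + 1) := by
  refine (degLT_numerator le_rfl lowersDeg_gX_derivX c e S
    (degLT_exponent gX_injective le_rfl lowersDeg_gX_derivX hb hU) ?_).mono ?_
  all_goals simp only [gX_apply]; omega

theorem degLT_gX_expNum_derivY (hb : b ≠ 0) (hU : b * U = derivY K b * bs) {α β B φ : ℕ}
    (c : σ → K[X][X]) (e : σ → K) {S : Finset σ} (hβ : a.natDegree = b.natDegree + β + 1)
    (hα : b.natDegree + bs.natDegree + ∑ i ∈ S, (c i).natDegree = α)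
    (hB : B + φ = α + β + 1) (hφ : φ ≤ 1)
    (hφ' : φ = 1 → ∃ κ : K, a.leadingCoeff = C κ * b.leadingCoeff) :
    DegLT (gX K) (expNum (derivY K) a b bs U c e S) (B + 1) := by
  have hT : DegLT (gX K) (derivY K a * bs - a * U) (a.natDegree + bs.natDegree + 1 - φ) := by
    rcases Nat.le_one_iff_eq_zero_or_eq_one.mp hφ with rfl | rfl
    · exact degLT_exponent gX_injective zero_le_one lowersDeg_gX_derivY hb hU
    · obtain ⟨κ, hκ⟩ := hφ' rfl
      exact degLT_exponent_of_leadingCoeff hb hU hκ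
  refine (degLT_numerator zero_le_one lowersDeg_gX_derivY c e S hT ?_).mono ?_
  all_goals simp only [gX_apply]; omega

variable {γ : ℕ} (c : σ → K[X][X]) (e : σ → K) {S : Finset σ}

theorem degLT_gY_expNum {D : Derivation K K[X][X] K[X][X]} {k : ℕ} (hk : k ≤ 1)
    (hD : LowersDeg (gY K) D k) (hb : b ≠ 0) (hU : b * U = D b * bs)
    (hγ : degY bs + max (degY a) (degY b) + ∑ i ∈ S, degY (c i) = γ) :
    DegLT (gY K) (expNum D a b bs U c e S) (γ + 1 - k) := by
  refine (degLT_numerator (N := degY bs + max (degY a) (degY b) + 1 - k) hk hD c e S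
    ((degLT_exponent gY_injective hk hD hb hU).mono ?_) ?_).mono ?_
  all_goals simp only [natDegree_gY]; omega

theorem degLT_expNum_logDen (hc : ∀ i, c i ≠ 0) (hb : b ≠ 0) (hbs : bs ≠ 0)
    (hT : derivY K a * bs - a * U = 0) (S : Finset σ) :
    DegLT (gY K) (expNum (derivY K) a b bs U c e S) (degY (logDen b bs c S)) := by
  rw [expNum, hT, zero_mul, zero_add]
  exact degLT_logNum_denominator hc e S hb hbs

variable {E : Type*} [Field E] {Δ : E → E} {ι : K[X][X] →+* E}
  {D : Derivation K K[X][X] K[X][X]}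

/-- Passing from `h` to the cofactor of a polynomial factor in a logarithmic derivative. -/
theorem deriv_div_mul_eq (hΔmul : ∀ u v : E, Δ (u * v) = Δ u * v + u * Δ v)
    (hinj : Function.Injective ι) (hΔι : ∀ q, Δ (ι q) = ι (D q)) {f W F : K[X][X]} {h : E}
    (hf : f ≠ 0) (hh : Δ h * ι (f * W) = ι (D f * W + f * F) * h) :
    Δ (h / ι f) * ι W = ι F * (h / ι f) := by
  have hf' : ι f ≠ 0 := (map_ne_zero_iff ι hinj).mpr hf
  obtain ⟨z, hz⟩ : ∃ z, z = h / ι f := ⟨_, rfl⟩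
  have hz' : h = ι f * z := by rw [hz]; field_simp
  rw [← hz]
  rw [hz', hΔmul, hΔι] at hh
  simp only [map_mul, map_add] at hh
  refine mul_left_cancel₀ (mul_ne_zero hf' hf') ?_
  linear_combination hh

theorem deriv_div_logDen (hΔmul : ∀ u v : E, Δ (u * v) = Δ u * v + u * Δ v)
    (hinj : Function.Injective ι) (hΔι : ∀ q, Δ (ι q) = ι (D q)) {c0 : K[X][X]} {h : E}
    (hb : b ≠ 0) (hc0 : c0 ≠ 0) (hU : b * U = D b * bs)
    (hh : Δ h * ι (c0 * b ^ 2 * ∏ i ∈ S, c i) = h * ι (D c0 * b ^ 2 * ∏ i ∈ S, c i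
      + (D a * b - a * D b) * c0 * ∏ i ∈ S, c i + c0 * b ^ 2 * logNum D c e S)) :
    Δ (h / ι c0) * ι (logDen b bs c S) = ι (expNum D a b bs U c e S) * (h / ι c0) := by
  refine deriv_div_mul_eq hΔmul hinj hΔι hc0 ?_
  have hb' : ι b ≠ 0 := (map_ne_zero_iff ι hinj).mpr hb
  refine mul_left_cancel₀ hb' ?_
  have hU' := congrArg ι hU
  simp only [logDen, expNum, map_mul, map_add, map_sub, map_pow] at hU' hh ⊢
  linear_combination ι bs * hh + ι c0 * ι a * (ι (∏ i ∈ S, c i)) * h * hU'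

theorem deriv_div_pow_logDen_erase (hΔmul : ∀ u v : E, Δ (u * v) = Δ u * v + u * Δ v)
    (hinj : Function.Injective ι) (hΔι : ∀ q, Δ (ι q) = ι (D q)) {H : E} {l : σ} {m : ℕ}
    (hl : l ∈ S) (hcl : c l ≠ 0) (hel : e l = m)
    (hH : Δ H * ι (logDen b bs c S) = ι (expNum D a b bs U c e S) * H) :
    Δ (H / ι (c l ^ m)) * ι (logDen b bs c (S.erase l)) =
      ι (expNum D a b bs U c e (S.erase l)) * (H / ι (c l ^ m)) := by
  refine deriv_div_mul_eq hΔmul hinj hΔι (pow_ne_zero _ hcl) ?_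
  have hcl' : ι (c l) ≠ 0 := (map_ne_zero_iff ι hinj).mpr hcl
  refine mul_left_cancel₀ hcl' ?_
  rw [logDen_eq_mul b bs c hl, expNum_eq_add D a b bs U c e hl, hel, Nat.cast_smul_eq_nsmul,
    nsmul_eq_mul] at hH
  have h1 := congrArg ι (mul_derivation_pow D (c l) m)
  simp only [map_mul, map_add, map_pow, map_natCast] at hH h1 ⊢
  linear_combination ι (c l) ^ m * hH - ι (logDen b bs c (S.erase l)) * H * h1

end StandardForm

section Kernel

variable {K : Type*} [Field K] {σ : Type*} [DecidableEq σ]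
  {a b bs Ux Uy : K[X][X]} {c : σ → K[X][X]} {e : σ → K} {S : Finset σ}

theorem degY_eq_zero_of_no_common_prime
    (hbsb : ∀ q : K[X][X], Prime q → (q ∣ bs ↔ q ∣ b))
    {a' b' : K[X]} (hb' : b' ≠ 0) (hab : a * liftX b' = b * liftX a')
    (hP : ∀ p : K[X][X], Prime p → 0 < degY p → p ∣ logDen b bs c S →
      p ∣ expNum (derivX K) a b bs Ux c e S → ¬ p ∣ expNum (derivY K) a b bs Uy c e S) :
    degY b = 0 := by
  by_contra hne
  obtain ⟨p, hp, hpY, hpb⟩ := exists_prime_dvd_of_degY_pos b (Nat.pos_of_ne_zero hne)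
  have hpbs : p ∣ bs := (hbsb p hp).mpr hpb
  have hpa : p ∣ a := by
    refine (hp.dvd_or_dvd (hab ▸ hpb.mul_right _ : p ∣ a * liftX b')).resolve_right fun h => ?_
    have hl : liftX b' ≠ 0 := (Polynomial.map_ne_zero_iff C_injective).mpr hb'
    have := degY_le_of_dvd hl h
    rw [degY_liftX] at this
    omega
  have hF : ∀ (D : Derivation K K[X][X] K[X][X]) U, p ∣ expNum D a b bs U c e S := fun D U =>
    dvd_add ((dvd_sub (hpbs.mul_left _) (hpa.mul_right _)).mul_right _)
      ((hpbs.mul_left _).mul_right _)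
  exact hP p hp hpY ((hpbs.mul_left _).mul_right _) (hF _ _) (hF _ _)

theorem exponent_eq_of_no_common_prime [CharZero K] (hb : b ≠ 0)
    (hbsb : ∀ q : K[X][X], Prime q → (q ∣ bs ↔ q ∣ b))
    {a' b' : K[X]} (hb' : b' ≠ 0) (hab : a * liftX b' = b * liftX a')
    (hP : ∀ p : K[X][X], Prime p → 0 < degY p → p ∣ logDen b bs c S →
      p ∣ expNum (derivX K) a b bs Ux c e S → ¬ p ∣ expNum (derivY K) a b bs Uy c e S)
    {s : K[X][X]} {r : ℕ} (hs : s ≠ 0)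
    (h : antiOp (logDen b bs c S) (expNum (derivY K) a b bs Uy c e S) r s = 0)
    {l : σ} (hl : l ∈ S) (hlY : 0 < degY (c l)) :
    ∃ n : ℕ, (n : K) + 1 - r + e l = 0 := by
  have hbY := degY_eq_zero_of_no_common_prime hbsb hb' hab hP
  obtain ⟨p, hp, hpY, hpc⟩ := exists_prime_dvd_of_degY_pos _ hlY
  have hpb : ¬ p ∣ b := fun h => by
    have := degY_le_of_dvd hb h
    omega
  have hpbb : ¬ p ∣ b * bs := fun h =>
    (hp.dvd_or_dvd h).elim hpb fun h => hpb ((hbsb p hp).mp h)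
  have hW : ¬ p ^ 2 ∣ logDen b bs c S := fun h2 => by
    have h3 : p ^ 2 ∣ ∏ i ∈ S, c i := hp.pow_dvd_of_dvd_mul_left 2 hpbb h2
    have h4 : p ∣ ∏ i ∈ S, c i := (dvd_pow_self p two_ne_zero).trans h3
    have hF : ∀ (D : Derivation K K[X][X] K[X][X]) U, p ∣ expNum D a b bs U c e S := fun D U =>
      dvd_add (h4.mul_left _) ((dvd_logNum hp h3).mul_left _)
    exact hP p hp hpY (h4.mul_left _) (hF _ _) (hF _ _)
  rw [logDen_eq_mul b bs c hl] at hW h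
  rw [expNum_eq_add (derivY K) a b bs Uy c e hl] at h
  exact exponent_of_antiOp_eq_zero hp hpY hpc hW hs h

end Kernel

theorem exists_factor_of_degree_lt {K : Type*} [Field K] [CharZero K] {L : ℕ}
    {c : Fin L → K[X][X]} {e : Fin L → K} {r Y : ℕ}
    (he : ∀ l, degY (c l) = 0 ∨ ∃ n : ℕ, (n : K) + 1 - r + e l = 0)
    (hY : ¬ ((∀ l, degY (c l) = 0 ∨ ∃ n : ℤ, e l = (n : K)) ∧
      ∃ η : ℤ, (η : K) = ∑ l, e l * (degY (c l) : K) ∧ η ≤ (Y : ℤ))) :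
    ∃ (l : Fin L) (m : ℕ), e l = m ∧ m + 1 ≤ r ∧ 1 ≤ degY (c l) := by
  have hz : ∀ l, ∃ z : ℤ, (degY (c l) = 0 ∨ e l = (z : K)) ∧ z ≤ r - 1 := by
    intro l
    rcases he l with h | ⟨n, hn⟩
    · exact ⟨r - 1, Or.inl h, le_rfl⟩
    · refine ⟨r - 1 - n, Or.inr ?_, by omega⟩
      push_cast
      linear_combination hn
  choose z hz hzr using hz
  by_contra hcon
  push Not at hcon
  refine hY ⟨fun l => (hz l).imp_right fun h => ⟨z l, h⟩, ∑ l, z l * (degY (c l) : ℤ), ?_, ?_⟩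
  · push_cast
    refine Finset.sum_congr rfl fun l _ => ?_
    rcases hz l with h | h <;> simp [h]
  · refine le_trans (Finset.sum_nonpos fun l _ => ?_) (Int.natCast_nonneg Y)
    rcases Nat.eq_zero_or_pos (degY (c l)) with h0 | h0
    · simp [h0]
    · have hel := (hz l).resolve_left h0.ne'
      refine mul_nonpos_of_nonpos_of_nonneg ?_ (Int.natCast_nonneg _)
      by_contra hpos
      have h1 := hcon l (z l).toNat (by
        rw [hel, ← Int.cast_natCast, Int.toNat_of_nonneg (by omega)])
      have h2 := hzr l
      have h3 := h1 (by omega)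
      omega

section Main

variable {K : Type*} [Field K] [CharZero K] {E : Type*} [Field E] {Dx Dy : E → E}
  {ι : K[X][X] →+* E} {L : ℕ} {a b c0 bs Ux Uy : K[X][X]} {c : Fin L → K[X][X]} {e : Fin L → K}
  {H : E} {α β γ B φ₁ r t d : ℕ}

/-- The case where the denominator and both numerators of the logarithmic derivatives share a
factor `p` involving `y`: cancelling `p` lowers the degree in `y`. -/
theorem exists_telescoper_of_common_prime (hDxmul : ∀ u v : E, Dx (u * v) = Dx u * v + u * Dx v)
    (hDymul : ∀ u v : E, Dy (u * v) = Dy u * v + u * Dy v)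
    (hinj : Function.Injective ι) (hDxι : ∀ q : K[X][X], Dx (ι q) = ι (derivative q))
    (hDyι : ∀ q : K[X][X], Dy (ι q) = ι (DY q))
    {W Fx Fy p : K[X][X]} (hW : W ≠ 0) (hc : c0 ≠ 0)
    (hHx : Dx H * ι W = ι Fx * H) (hHy : Dy H * ι W = ι Fy * H)
    (hpY : 0 < degY p) (hpW : p ∣ W) (hpx : p ∣ Fx) (hpy : p ∣ Fy)
    (hFyW : DegLT (gY K) Fy (degY W))
    (hWX : DegLT (gX K) W (α + 1)) (hFxX : DegLT (gX K) Fx (α + β + 1))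
    (hWB : DegLT (gX K) W (B + 1)) (hFyB : DegLT (gX K) Fy (B + 1))
    (hWY : DegLT (gY K) W (γ + 1)) (hFxY : DegLT (gY K) Fx (γ + 1)) (hFyY : DegLT (gY K) Fy γ)
    (htr : t ≤ r) (hγ : 1 ≤ γ) (hr : γ ≤ r + 1)
    (hcount : 0 < 2 * ((r + 1 : ℤ) * (d + 1)) - β * (t * (t + 1))
      - 2 * ((d + 1 + c0.natDegree + r * α + (r - t) * β) * (γ - 1))
      - 2 * (B * (degY c0 + r * γ + 2 - γ))) :
    ∃ p : ℕ → K[X], (∃ i ≤ r, p i ≠ 0) ∧ (∀ i ≤ r, (p i).natDegree ≤ d) ∧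
      ∃ u v : K[X][X], v ≠ 0 ∧
        ∑ i ∈ Finset.range (r + 1), ι (liftX (p i)) * Dx^[i] (ι c0 * H)
          = Dy (ι u * (ι c0 * H) / ι v) := by
  have hp : p ≠ 0 := fun h => by simp [h, degY] at hpY
  have hp' : ι p ≠ 0 := (map_ne_zero_iff ι hinj).mpr hp
  obtain ⟨W, rfl⟩ := hpW
  obtain ⟨Fx, rfl⟩ := hpx
  obtain ⟨Fy, rfl⟩ := hpy
  have hW' : W ≠ 0 := right_ne_zero_of_mul hW
  obtain ⟨γ, rfl⟩ := Nat.exists_eq_add_of_le' hγ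
  rw [degY_mul hp hW', ← natDegree_gY p] at hFyW
  obtain ⟨J, hJ, hJ'⟩ := exists_degY_set r hW' (DegLT.of_mul gY_injective hp hFyW)
  have hX : ∀ {f : K[X][X]} {n : ℕ}, DegLT (gX K) (p * f) n → DegLT (gX K) f n := fun h =>
    DegLT.of_mul gX_injective hp (h.mono (Nat.le_add_left _ _))
  have hY : ∀ {f : K[X][X]} {n : ℕ}, DegLT (gY K) (p * f) (n + 1) → DegLT (gY K) f n := fun h =>
    DegLT.of_mul gY_injective hp (h.mono (by rw [natDegree_gY]; omega))
  rw [map_mul, map_mul] at hHx hHy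
  refine exists_telescoper (γ := γ) (j := 1) hDxmul hDymul hinj hDxι hDyι hW' hc
    (mul_left_cancel₀ hp' (by linear_combination hHx))
    (mul_left_cancel₀ hp' (by linear_combination hHy))
    (hX hWX) (hX hFxX) (hX hWB) (hX hFyB) (hY hWY) (hY hFxY) (hY hFyY)
    (degLT_natDegree _ c0) (degLT_natDegree _ c0) hJ hJ' htr ?_ ?_
  · rcases Nat.eq_zero_or_pos γ with rfl | hγ
    · omega
    · have := Nat.le_mul_of_pos_right r hγ
      omega
  · refine lt_of_lt_of_le hcount ?_
    rw [natDegree_gY, gX_apply]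
    push_cast
    have h1 : (0 : ℤ) ≤ B * r := by positivity
    linarith

/-- The case where a factor with a positive integer exponent can be moved to the polynomial
part. -/
theorem exists_telescoper_of_factor (hDxmul : ∀ u v : E, Dx (u * v) = Dx u * v + u * Dx v)
    (hDymul : ∀ u v : E, Dy (u * v) = Dy u * v + u * Dy v)
    (hinj : Function.Injective ι) (hDxι : ∀ q : K[X][X], Dx (ι q) = ι (derivative q))
    (hDyι : ∀ q : K[X][X], Dy (ι q) = ι (DY q))
    (hb : b ≠ 0) (hbs : bs ≠ 0) (hc0 : c0 ≠ 0) (hc : ∀ l, c l ≠ 0)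
    (hUx : b * Ux = derivX K b * bs) (hUy : b * Uy = derivY K b * bs)
    (hHx : Dx H * ι (logDen b bs c univ) = ι (expNum (derivX K) a b bs Ux c e univ) * H)
    (hHy : Dy H * ι (logDen b bs c univ) = ι (expNum (derivY K) a b bs Uy c e univ) * H)
    (hT : derivY K a * bs - a * Uy = 0)
    (hβ : a.natDegree = b.natDegree + β + 1)
    (hα : b.natDegree + bs.natDegree + ∑ l, (c l).natDegree = α)
    (hγ : degY bs + max (degY a) (degY b) + ∑ l, degY (c l) = γ)
    (hB : B + φ₁ = α + β + 1) (hφ₁ : φ₁ ≤ 1)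
    (hφ₁' : φ₁ = 1 → ∃ κ : K, a.leadingCoeff = C κ * b.leadingCoeff)
    {l : Fin L} {m : ℕ} (hm : e l = m) (hmr : m + 1 ≤ r) (hl : 1 ≤ degY (c l))
    (htr : t ≤ r)
    (hcount : 0 < 2 * ((r + 1 : ℤ) * (d + 1)) - β * (t * (t + 1))
      - 2 * ((d + 1 + c0.natDegree + r * α + (r - t) * β) * (γ - 1))
      - 2 * (B * (degY c0 + r * γ + 2 - γ))) :
    ∃ p : ℕ → K[X], (∃ i ≤ r, p i ≠ 0) ∧ (∀ i ≤ r, (p i).natDegree ≤ d) ∧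
      ∃ u v : K[X][X], v ≠ 0 ∧
        ∑ i ∈ Finset.range (r + 1), ι (liftX (p i)) * Dx^[i] (ι c0 * H)
          = Dy (ι u * (ι c0 * H) / ι v) := by
  have hl' := Finset.mem_univ l
  have hcm : c l ^ m ≠ 0 := pow_ne_zero _ (hc l)
  have hcm' : ι (c l ^ m) ≠ 0 := (map_ne_zero_iff ι hinj).mpr hcm
  have hH : ι c0 * H = ι (c0 * c l ^ m) * (H / ι (c l ^ m)) := by
    rw [map_mul]
    field_simp
  rw [hH]
  set S := (univ : Finset (Fin L)).erase l
  obtain ⟨ξ, hξ⟩ : ∃ ξ, (c l).natDegree = ξ := ⟨_, rfl⟩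
  obtain ⟨δ, hδ⟩ : ∃ δ, degY (c l) = δ := ⟨_, rfl⟩
  obtain ⟨α', hα'⟩ : ∃ α', b.natDegree + bs.natDegree + ∑ l ∈ S, (c l).natDegree = α' := ⟨_, rfl⟩
  obtain ⟨γ', hγ'⟩ : ∃ γ', degY bs + max (degY a) (degY b) + ∑ l ∈ S, degY (c l) = γ' := ⟨_, rfl⟩
  have hαξ : α = α' + ξ := by
    rw [← hα, ← hα', ← hξ, ← Finset.sum_erase_add _ _ hl']
    ring
  have hγδ : γ = γ' + δ := by
    rw [← hγ, ← hγ', ← hδ, ← Finset.sum_erase_add _ _ hl']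
    ring
  have hW := logDen_ne_zero hb hbs hc S
  obtain ⟨J, hJ, hJ'⟩ := exists_degY_set r hW (degLT_expNum_logDen c e hc hb hbs hT S)
  have hWX := degLT_gX_logDen c hα'
  refine exists_telescoper (γ := γ') (j := 1) (α := α') (β := β) (B := B)
    (C := c0.natDegree + m * ξ) (Y := degY c0 + m * δ)
    hDxmul hDymul hinj hDxι hDyι hW (mul_ne_zero hc0 hcm)
    (deriv_div_pow_logDen_erase (D := derivX K) c e hDxmul hinj hDxι hl' (hc l) hm hHx)
    (deriv_div_pow_logDen_erase (D := derivY K) c e hDymul hinj hDyι hl' (hc l) hm hHy)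
    hWX (degLT_gX_expNum_derivX hb hUx c e hβ hα') (hWX.mono (by omega))
    ((degLT_gX_expNum_derivY (B := α' + β + 1 - φ₁) hb hUy c e hβ hα' (by omega) hφ₁ hφ₁').mono
      (by omega))
    (degLT_gY_logDen c hγ') (degLT_gY_expNum c e zero_le_one lowersDeg_gY_derivX hb hUx hγ')
    (degLT_gY_expNum c e le_rfl lowersDeg_gY_derivY hb hUy hγ')
    ?_ ?_ hJ hJ' htr ?_ ?_
  · have h1 := (degLT_natDegree (gX K) c0).mul ((degLT_natDegree (gX K) (c l)).pow m)
    rwa [gX_apply, gX_apply, hξ] at h1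
  · have h1 := (degLT_natDegree (gY K) c0).mul ((degLT_natDegree (gY K) (c l)).pow m)
    rwa [natDegree_gY, natDegree_gY, hδ] at h1
  · have := Nat.le_mul_of_pos_left γ' (show 0 < r by omega)
    omega
  · refine lt_of_lt_of_le hcount ?_
    obtain ⟨k, rfl⟩ := Nat.exists_eq_add_of_le hmr
    obtain ⟨q, hq⟩ := Nat.exists_eq_add_of_le htr
    obtain ⟨δ, rfl⟩ := Nat.exists_eq_add_of_le (hδ ▸ hl)
    have hq' : ((m + 1 + k : ℕ) : ℤ) - t = q := by rw [hq]; push_cast; ring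
    rw [hq', hαξ, hγδ]
    push_cast
    have h1 : (0 : ℤ) ≤ (d + 1 + c0.natDegree + (m + 1 + k) * (α' + ξ) + q * β) * δ := by positivity
    have h2 : (0 : ℤ) ≤ (1 + k) * ξ * γ' := by positivity
    have h3 : (0 : ℤ) ≤ B * (1 + k * (1 + δ)) := by positivity
    linear_combination 2 * h1 + 2 * h2 + 2 * h3

theorem exists_telescoper_of_standard_form
    (hDxmul : ∀ u v : E, Dx (u * v) = Dx u * v + u * Dx v)
    (hDymul : ∀ u v : E, Dy (u * v) = Dy u * v + u * Dy v)
    (hinj : Function.Injective ι) (hDxι : ∀ q : K[X][X], Dx (ι q) = ι (derivative q))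
    (hDyι : ∀ q : K[X][X], Dy (ι q) = ι (DY q))
    (hb : b ≠ 0) (hbs : bs ≠ 0) (hc0 : c0 ≠ 0) (hc : ∀ l, c l ≠ 0)
    (hbsb : ∀ q : K[X][X], Prime q → (q ∣ bs ↔ q ∣ b))
    (hUx : b * Ux = derivX K b * bs) (hUy : b * Uy = derivY K b * bs)
    (hHx : Dx H * ι (logDen b bs c univ) = ι (expNum (derivX K) a b bs Ux c e univ) * H)
    (hHy : Dy H * ι (logDen b bs c univ) = ι (expNum (derivY K) a b bs Uy c e univ) * H)
    (hβ : a.natDegree = b.natDegree + β + 1)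
    (hα : b.natDegree + bs.natDegree + ∑ l, (c l).natDegree = α)
    (hγ : degY bs + max (degY a) (degY b) + ∑ l, degY (c l) = γ)
    (hB : B + φ₁ = α + β + 1) (hφ₁ : φ₁ ≤ 1)
    (hφ₁' : φ₁ = 1 → ∃ κ : K, a.leadingCoeff = C κ * b.leadingCoeff)
    {φ₃ : ℕ} (hφ₃a : φ₃ ≤ 1)
    (hφ₃ : φ₃ = 1 ↔
      ((∃ a' b' : K[X], b' ≠ 0 ∧ a * liftX b' = b * liftX a') ∧
       (∀ l, degY (c l) = 0 ∨ ∃ n : ℤ, e l = (n : K)) ∧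
       (∃ η : ℤ, (η : K) = ∑ l, e l * (degY (c l) : K) ∧ η ≤ (degY c0 : ℤ))))
    (htr : t ≤ r) (hγ1 : 1 ≤ γ) (hr : γ + φ₃ ≤ r + 1)
    (hcount : 0 < 2 * ((r + 1 : ℤ) * (d + 1)) - β * (t * (t + 1))
      - 2 * ((d + 1 + c0.natDegree + r * α + (r - t) * β) * (γ + φ₃ - 1))
      - 2 * (B * (degY c0 + r * γ + 2 - γ - φ₃))) :
    ∃ p : ℕ → K[X], (∃ i ≤ r, p i ≠ 0) ∧ (∀ i ≤ r, (p i).natDegree ≤ d) ∧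
      ∃ u v : K[X][X], v ≠ 0 ∧
        ∑ i ∈ Finset.range (r + 1), ι (liftX (p i)) * Dx^[i] (ι c0 * H)
          = Dy (ι u * (ι c0 * H) / ι v) := by
  have hW := logDen_ne_zero hb hbs hc univ
  have hWX := degLT_gX_logDen c hα
  have hFxX := degLT_gX_expNum_derivX hb hUx c e hβ hα
  have hWB : DegLT (gX K) (logDen b bs c univ) (B + 1) := hWX.mono (by omega)
  have hFyB := degLT_gX_expNum_derivY hb hUy c e hβ hα hB hφ₁ hφ₁'
  have hWY := degLT_gY_logDen c hγ
  have hFxY := degLT_gY_expNum c e zero_le_one lowersDeg_gY_derivX hb hUx hγ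
  have hFyY := degLT_gY_expNum c e le_rfl lowersDeg_gY_derivY hb hUy hγ
  have generic : ∀ J : Finset ℕ, J.card ≤ φ₃ →
      (∀ s, s ≠ 0 → antiOp (logDen b bs c univ) (expNum (derivY K) a b bs Uy c e univ) r s = 0 →
        degY s ∈ J) → _ := fun J hJ hJ' =>
    exists_telescoper hDxmul hDymul hinj hDxι hDyι hW hc0 hHx hHy hWX hFxX hWB hFyB hWY hFxY hFyY
      (degLT_natDegree _ c0) (degLT_natDegree _ c0) hJ hJ' htr
      (by have := Nat.le_mul_of_pos_right r hγ1; omega)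
      (by rw [natDegree_gY, gX_apply]; exact hcount)
  rcases Nat.le_one_iff_eq_zero_or_eq_one.mp hφ₃a with h0 | h1
  · by_cases hker : ∃ s, s ≠ 0 ∧
        antiOp (logDen b bs c univ) (expNum (derivY K) a b bs Uy c e univ) r s = 0
    · obtain ⟨s, hs, hs'⟩ := hker
      obtain ⟨a', b', hb', hab⟩ := exists_liftX_of_antiOp_eq_zero hc hb hbs hUy hs hs'
      have hT := exponent_eq_zero_of_liftX hb hUy hb' hab
      subst h0
      simp only [Nat.cast_zero, add_zero, sub_zero] at hcount
      by_cases hP : ∃ p : K[X][X], Prime p ∧ 0 < degY p ∧ p ∣ logDen b bs c univ ∧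
        p ∣ expNum (derivX K) a b bs Ux c e univ ∧ p ∣ expNum (derivY K) a b bs Uy c e univ
      · obtain ⟨p, -, hpY, hpW, hpx, hpy⟩ := hP
        exact exists_telescoper_of_common_prime hDxmul hDymul hinj hDxι hDyι hW hc0 hHx hHy hpY
          hpW hpx hpy (degLT_expNum_logDen c e hc hb hbs hT univ) hWX hFxX hWB hFyB hWY hFxY hFyY
          htr hγ1 hr hcount
      · push Not at hP
        obtain ⟨l, m, hm, hmr, hl⟩ := exists_factor_of_degree_lt (c := c) (e := e) (r := r)
          (Y := degY c0)
          (fun l => (Nat.eq_zero_or_pos (degY (c l))).imp_right fun h =>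
            exponent_eq_of_no_common_prime hb hbsb hb' hab hP hs hs' (Finset.mem_univ l) h)
          (fun h => zero_ne_one (hφ₃.mpr ⟨⟨a', b', hb', hab⟩, h⟩))
        exact exists_telescoper_of_factor hDxmul hDymul hinj hDxι hDyι hb hbs hc0 hc hUx hUy hHx
          hHy hT hβ hα hγ hB hφ₁ hφ₁' hm hmr hl htr hcount
    · exact generic ∅ (by simp) fun s hs hs' => (hker ⟨s, hs, hs'⟩).elim
  · obtain ⟨⟨a', b', hb', hab⟩, -⟩ := hφ₃.mp h1
    obtain ⟨J, hJ, hJ'⟩ := exists_degY_set r hW (degLT_expNum_logDen c e hc hb hbs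
      (exponent_eq_zero_of_liftX hb hUy hb' hab) univ)
    exact generic J (h1 ▸ hJ) hJ'

end Main

/-- The bound on the degree `d` guarantees that there are more unknowns than equations. -/
theorem count_pos_of_degree_bound {α β γ C Y B φ₁ φ₂ φ₃ : ℕ} {r d : ℤ} (hγ : 1 ≤ γ)
    (hφ₁ : φ₁ ≤ 1) (hφ₂ : φ₂ ≤ 1) (hφ₃ : φ₃ ≤ 1) (hφ₁₂ : φ₂ = 1 → φ₁ = 1 ∧ β = 0)
    (hB : B + φ₁ = α + β + 1) (hr : ((γ : ℚ) + φ₃ - 2) + 1 ≤ r)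
    (hd : ((((α : ℚ) + β) * (2 * γ - 1 + φ₃) + γ - 1) * r + (C + (α + β + 1) * Y
        + (γ - 2 + φ₃) * (C - α - β - φ₂)
        - (1 - φ₂) * max ((γ : ℚ) - 2 + φ₃) 0 * (φ₁ + (1 / 2) * β * (γ - 1 + φ₃))))
          / (r - (γ + φ₃ - 2)) < d) :
    (γ : ℤ) + φ₃ ≤ r + 1 ∧ 0 ≤ d ∧
      0 < 2 * ((r + 1 : ℤ) * (d + 1)) - β * (((γ + φ₃ - 2 : ℕ) : ℤ) * ((γ + φ₃ - 2 : ℕ) + 1))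
        - 2 * ((d + 1 + C + r * α + (r - (γ + φ₃ - 2 : ℕ)) * β) * (γ + φ₃ - 1))
        - 2 * (B * (Y + r * γ + 2 - γ - φ₃)) := by
  have hr' : (γ : ℤ) + φ₃ ≤ r + 1 := by
    have : ((γ + φ₃ : ℤ) : ℚ) ≤ ((r + 1 : ℤ) : ℚ) := by push_cast; linarith
    exact_mod_cast this
  refine ⟨hr', ?_⟩
  rw [div_lt_iff₀ (by linarith)] at hd
  have hBz : (B : ℤ) + φ₁ = α + β + 1 := by exact_mod_cast hB
  rcases Nat.lt_or_ge (γ + φ₃) 2 with hlt | hge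
  · obtain rfl : γ = 1 := by omega
    obtain rfl : φ₃ = 0 := by omega
    norm_num at hd
    have hd' : ((α : ℤ) + β) * r + (C + (α + β + 1) * Y - (C - α - β - φ₂)) < d * (r + 1) := by
      have h : ((((α : ℤ) + β) * r + (C + (α + β + 1) * Y - (C - α - β - φ₂)) : ℤ) : ℚ)
          < ((d * (r + 1) : ℤ) : ℚ) := by
        push_cast
        linarith
      exact_mod_cast h
    push_cast at hr' ⊢
    have h0 : 0 ≤ (B : ℤ) * (Y + r + 1) := mul_nonneg (by positivity) (by omega)
    have h1 : 0 ≤ (φ₁ : ℤ) * (Y + r + 1) := mul_nonneg (by positivity) (by omega)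
    have key : (B : ℤ) * (Y + r + 1) < (r + 1) * (d + 1) := by
      have hB' : (B : ℤ) = α + β + 1 - φ₁ := by linarith
      rw [hB'] at h0 ⊢
      nlinarith
    constructor
    · by_contra hneg
      have : (r + 1) * (d + 1) ≤ 0 := mul_nonpos_of_nonneg_of_nonpos (by omega) (by omega)
      omega
    · norm_num
      linarith
  · obtain ⟨ψ, hψ⟩ := Nat.exists_eq_add_of_le' hge
    have hψz : (φ₃ : ℤ) = ψ + 2 - γ := by
      have : (γ : ℤ) + φ₃ = ψ + 2 := by exact_mod_cast hψ
      linarith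
    have hψq : (φ₃ : ℚ) = ψ + 2 - γ := by exact_mod_cast hψz
    have hψγ : ψ + 1 ≤ γ := by omega
    rw [hψq, max_eq_left (by ring_nf; positivity)] at hd
    rw [show γ + φ₃ - 2 = ψ by omega, hψz]
    rw [hψz] at hr'
    obtain ⟨k, hk⟩ : ∃ k : ℕ, r = ψ + 1 + k := Int.le.dest (by linarith) |>.imp fun _ h => h.symm
    obtain ⟨g, rfl⟩ := Nat.exists_eq_add_of_le hψγ
    subst hk
    have hd' : 2 * (((α + β) * (ψ + g + ψ + 2) + ψ + g) * (ψ + 1 + k : ℤ)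
        + (C + (α + β + 1) * Y + ψ * (C - α - β - φ₂)))
        - (1 - φ₂) * ψ * (2 * φ₁ + β * (ψ + 1)) < 2 * (d * (1 + k)) := by
      have h : ((2 * (((α + β) * (ψ + g + ψ + 2) + ψ + g) * (ψ + 1 + k : ℤ)
        + (C + (α + β + 1) * Y + ψ * (C - α - β - φ₂)))
        - (1 - φ₂) * ψ * (2 * φ₁ + β * (ψ + 1)) : ℤ) : ℚ) < ((2 * (d * (1 + k)) : ℤ) : ℚ) := by
        push_cast at hd ⊢
        linarith
      exact_mod_cast h
    have hB' : (α : ℤ) = B + φ₁ - β - 1 := by linarith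
    have hq : (0 : ℤ) ≤ Y + (ψ + 1 + k) * (ψ + 1 + g) - 2 * ψ := by
      have : (0 : ℤ) ≤ Y + (ψ * ψ + 1 + k * (ψ + 1) + g * (ψ + 1 + k)) := by positivity
      linarith
    have key : 2 * ((C + (ψ + 1 + k) * (α + β)) * (ψ + 1)
        + B * (Y + (ψ + 1 + k) * (ψ + 1 + g) - ψ)) - β * ψ * (ψ + 1)
        < 2 * ((1 + k) * (d + 1) : ℤ) := by
      rcases Nat.le_one_iff_eq_zero_or_eq_one.mp hφ₂ with rfl | rfl
      · have h1 := mul_nonneg (Int.natCast_nonneg φ₁) hq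
        rw [hB'] at hd' ⊢
        push_cast at hd'
        linarith
      · obtain ⟨rfl, rfl⟩ := hφ₁₂ rfl
        rw [hB'] at hd' ⊢
        push_cast at hd' ⊢
        linarith
    constructor
    · by_contra hneg
      have h1 : (1 + k : ℤ) * (d + 1) ≤ 0 :=
        mul_nonpos_of_nonneg_of_nonpos (by positivity) (by omega)
      have h2 : (0 : ℤ) ≤ B * (Y + (ψ + 1 + k) * (ψ + 1 + g) - ψ) :=
        mul_nonneg (by positivity) (by linarith [Int.natCast_nonneg ψ])
      have h3 : (0 : ℤ) ≤ 2 * (C + (ψ + 1 + k) * α + (1 + k) * β) * (ψ + 1) + β * ψ * (ψ + 1) := by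
        positivity
      linarith
    · push_cast
      linarith

theorem thm1_case1
    {K : Type*} {E : Type*} [Field K] [CharZero K] [Field E]
    (Dx Dy : E → E)
    (hDxadd : ∀ u v : E, Dx (u + v) = Dx u + Dx v)
    (hDxmul : ∀ u v : E, Dx (u * v) = Dx u * v + u * Dx v)
    (hDyadd : ∀ u v : E, Dy (u + v) = Dy u + Dy v)
    (hDymul : ∀ u v : E, Dy (u * v) = Dy u * v + u * Dy v)
    (hcomm : ∀ u : E, Dx (Dy u) = Dy (Dx u))
    (ι : Polynomial (Polynomial K) →+* E)
    (hinj : Function.Injective ι)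
    (hDxι : ∀ q : Polynomial (Polynomial K), Dx (ι q) = ι (Polynomial.derivative q))
    (hDyι : ∀ q : Polynomial (Polynomial K), Dy (ι q) = ι (DY q))
    (L : ℕ) (a b c0 bs : Polynomial (Polynomial K))
    (c : Fin L → Polynomial (Polynomial K)) (e : Fin L → K)
    (ha : a ≠ 0) (hb : b ≠ 0) (hc0 : c0 ≠ 0) (hc : ∀ ℓ, c ℓ ≠ 0)
    (hbs : Squarefree bs)
    (hbsb : ∀ q : Polynomial (Polynomial K), Prime q → (q ∣ bs ↔ q ∣ b))
    (h : E) (hh : h ≠ 0)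
    (hDxh : Dx h * ι (c0 * b ^ 2 * (∏ ℓ, c ℓ))
      = h * ι (Polynomial.derivative c0 * b ^ 2 * (∏ ℓ, c ℓ)
          + (Polynomial.derivative a * b - a * Polynomial.derivative b) * c0 * (∏ ℓ, c ℓ)
          + c0 * b ^ 2 * ∑ ℓ, e ℓ • (Polynomial.derivative (c ℓ) * ∏ j ∈ Finset.univ.erase ℓ, c j)))
    (hDyh : Dy h * ι (c0 * b ^ 2 * (∏ ℓ, c ℓ))
      = h * ι (DY c0 * b ^ 2 * (∏ ℓ, c ℓ)
          + (DY a * b - a * DY b) * c0 * (∏ ℓ, c ℓ)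
          + c0 * b ^ 2 * ∑ ℓ, e ℓ • (DY (c ℓ) * ∏ j ∈ Finset.univ.erase ℓ, c j)))
    (hce : ∀ ℓ, e ℓ ≠ 0)
    (hndx : 0 < max a.natDegree b.natDegree + ∑ ℓ, (c ℓ).natDegree)
    (hndy : 0 < max (degY a) (degY b) + ∑ ℓ, degY (c ℓ))
    (hdeg : b.natDegree < a.natDegree)
    (φ1 φ2 : ℕ) (hφ1a : φ1 ≤ 1)
    (hφ1 : φ1 = 1 ↔ ∃ k : K, a.leadingCoeff = Polynomial.C k * b.leadingCoeff)
    (hφ2a : φ2 ≤ 1)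
    (hφ2 : φ2 = 1 ↔
      ((∃ k : K, a.leadingCoeff = Polynomial.C k * b.leadingCoeff) ∧ ((a.natDegree : ℤ) - (b.natDegree : ℤ) - 1) = 0))
    (φ3 : ℕ) (hφ3a : φ3 ≤ 1)
    (hφ3 : φ3 = 1 ↔
      ((∃ a' b' : Polynomial K, b' ≠ 0 ∧ a * liftX b' = b * liftX a') ∧
       (∀ ℓ, degY (c ℓ) = 0 ∨ ∃ n : ℤ, e ℓ = (n : K)) ∧
       (∃ η : ℤ, (η : K) = ∑ ℓ, e ℓ * (degY (c ℓ) : K) ∧ η ≤ (degY c0 : ℤ))))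
    (r d : ℤ)
    (hr : (((degY bs : ℚ) + (max (degY a) (degY b) : ℚ) + ∑ ℓ, (degY (c ℓ) : ℚ)) + (φ3 : ℚ) - 2) + 1 ≤ (r : ℚ))
    (hd : (((((bs.natDegree : ℚ) + (b.natDegree : ℚ) + ∑ ℓ, ((c ℓ).natDegree : ℚ)) + ((a.natDegree : ℚ) - (b.natDegree : ℚ) - 1)) * (2 * ((degY bs : ℚ) + (max (degY a) (degY b) : ℚ) + ∑ ℓ, (degY (c ℓ) : ℚ)) - 1 + (φ3 : ℚ)) + ((degY bs : ℚ) + (max (degY a) (degY b) : ℚ) + ∑ ℓ, (degY (c ℓ) : ℚ)) - 1) * (r : ℚ) + ((c0.natDegree : ℚ) + (((bs.natDegree : ℚ) + (b.natDegree : ℚ) + ∑ ℓ, ((c ℓ).natDegree : ℚ)) + ((a.natDegree : ℚ) - (b.natDegree : ℚ) - 1) + 1) * (degY c0 : ℚ)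
        + (((degY bs : ℚ) + (max (degY a) (degY b) : ℚ) + ∑ ℓ, (degY (c ℓ) : ℚ)) - 2 + (φ3 : ℚ))
            * ((c0.natDegree : ℚ) - ((bs.natDegree : ℚ) + (b.natDegree : ℚ) + ∑ ℓ, ((c ℓ).natDegree : ℚ)) - ((a.natDegree : ℚ) - (b.natDegree : ℚ) - 1) - (φ2 : ℚ))
        - (1 - (φ2 : ℚ)) * max (((degY bs : ℚ) + (max (degY a) (degY b) : ℚ) + ∑ ℓ, (degY (c ℓ) : ℚ)) - 2 + (φ3 : ℚ)) 0
            * ((φ1 : ℚ) + (1 / 2) * ((a.natDegree : ℚ) - (b.natDegree : ℚ) - 1) * (((degY bs : ℚ) + (max (degY a) (degY b) : ℚ) + ∑ ℓ, (degY (c ℓ) : ℚ)) - 1 + (φ3 : ℚ))))) / ((r : ℚ) - (((degY bs : ℚ) + (max (degY a) (degY b) : ℚ) + ∑ ℓ, (degY (c ℓ) : ℚ)) + (φ3 : ℚ) - 2))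
            < (d : ℚ)) :
    ∃ p : ℕ → Polynomial K,
      (∃ i ≤ r.toNat, p i ≠ 0) ∧
      (∀ i ≤ r.toNat, ((p i).natDegree : ℤ) ≤ d) ∧
      ∃ u v : Polynomial (Polynomial K), v ≠ 0 ∧
        ∑ i ∈ Finset.range (r.toNat + 1), ι (liftX (p i)) * Dx^[i] h
          = Dy (ι u * h / ι v) := by
  classical
  have hbs0 : bs ≠ 0 := hbs.ne_zero
  obtain ⟨Ux, hUx⟩ := dvd_derivation_mul (derivX K) b bs fun q hq => (hbsb q hq).mpr
  obtain ⟨Uy, hUy⟩ := dvd_derivation_mul (derivY K) b bs fun q hq => (hbsb q hq).mpr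
  obtain ⟨β, hβ⟩ := Nat.exists_eq_add_of_lt hdeg
  obtain ⟨α, hα⟩ : ∃ α, b.natDegree + bs.natDegree + ∑ ℓ, (c ℓ).natDegree = α := ⟨_, rfl⟩
  obtain ⟨γ, hγ⟩ : ∃ γ, degY bs + max (degY a) (degY b) + ∑ ℓ, degY (c ℓ) = γ := ⟨_, rfl⟩
  have hαq : (bs.natDegree : ℚ) + b.natDegree + ∑ ℓ, ((c ℓ).natDegree : ℚ) = α := by
    rw [← hα]
    push_cast
    ring
  have hγq : (degY bs : ℚ) + max (degY a : ℚ) (degY b) + ∑ ℓ, (degY (c ℓ) : ℚ) = γ := by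
    rw [← hγ]
    push_cast
    ring
  have hβq : (a.natDegree : ℚ) - b.natDegree - 1 = β := by
    rw [hβ]
    push_cast
    ring
  rw [hγq] at hr
  rw [hαq, hγq, hβq] at hd
  have hφ₁₂ : φ2 = 1 → φ1 = 1 ∧ β = 0 := fun h2 => by
    obtain ⟨h3, h4⟩ := hφ2.mp h2
    exact ⟨hφ1.mpr h3, by omega⟩
  obtain ⟨hr', hd0, hcount⟩ := count_pos_of_degree_bound (B := α + β + 1 - φ1) (by omega) hφ1a
    hφ2a hφ3a hφ₁₂ (by omega) hr hd
  obtain ⟨d, rfl⟩ := Int.eq_ofNat_of_zero_le hd0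
  obtain ⟨r, rfl⟩ := Int.eq_ofNat_of_zero_le (show 0 ≤ r by omega)
  have hc0' : ι c0 ≠ 0 := (map_ne_zero_iff ι hinj).mpr hc0
  have hH : ι c0 * (h / ι c0) = h := by field_simp
  obtain ⟨p, hp0, hpd, hrel⟩ := exists_telescoper_of_standard_form (H := h / ι c0)
    hDxmul hDymul hinj hDxι hDyι hb hbs0 hc0 hc hbsb hUx.symm hUy.symm
    (deriv_div_logDen (D := derivX K) c e hDxmul hinj hDxι hb hc0 hUx.symm hDxh)
    (deriv_div_logDen (D := derivY K) c e hDymul hinj hDyι hb hc0 hUy.symm hDyh)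
    hβ hα hγ (B := α + β + 1 - φ1) (φ₁ := φ1) (by omega) hφ1a hφ1.mp hφ3a hφ3
    (r := r) (t := γ + φ3 - 2) (d := d) (by omega) (by omega) (by omega) hcount
  rw [hH] at hrel
  exact ⟨p, hp0, fun i hi => Int.ofNat_le.mpr (hpd i hi), hrel⟩
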